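/- arXiv:1404.0907 — 4 statements merged into one kernel-verified Lean document; each statement's English description precedes it below -/
import Mathlib

section
/- Let H₁ and H₂ be Hilbert spaces and let S ∈ L(H₁,H₂) and T ∈ L(H₂,H₁) be such that R(TS) and R(ST) are finite-dimensional subspaces of H₁ and H₂ respectively. Let H = H₁ ⊕ H₂ (orthogonal direct sum), let U ∈ L(H) be the block operator U = [[0, T],[S, 0]], and let V = U + U*. Then the following statements are equivalent: (i) V is a Fredholm operator; (ii) V² is a Fredholm operator; (iii) UU* + U*U is a Fredholm operator; (iv) TT* + S*S ∈ L(H₁) and SS* + T*T ∈ L(H₂) are Fredholm operators. -/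
open Module ContinuousLinearMap

noncomputable section

set_option maxHeartbeats 1000000
set_option synthInstance.maxHeartbeats 1000000

/-- For submodules `p q` of a space `E`, the quotient space `p / (p ⊓ q)`. -/
abbrev relQuot {E : Type*} [AddCommGroup E] [Module ℂ E] (p q : Submodule ℂ E) : Type _ :=
  ↥p ⧸ ((p ⊓ q).comap p.subtype)

section Defs

variable {H₁ H₂ : Type*} [NormedAddCommGroup H₁] [NormedSpace ℂ H₁]
  [NormedAddCommGroup H₂] [NormedSpace ℂ H₂]

/-- `(S, T)` is a Fredholm pair if the four quotients `N(S)/(N(S) ⊓ R(T))`,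
`R(T)/(N(S) ⊓ R(T))`, `N(T)/(N(T) ⊓ R(S))`, `R(S)/(N(T) ⊓ R(S))` are finite dimensional. -/
def IsFredholmPair (S : H₁ →L[ℂ] H₂) (T : H₂ →L[ℂ] H₁) : Prop :=
  FiniteDimensional ℂ (relQuot (LinearMap.ker (S : H₁ →ₗ[ℂ] H₂)) (LinearMap.range (T : H₂ →ₗ[ℂ] H₁))) ∧
  FiniteDimensional ℂ (relQuot (LinearMap.range (T : H₂ →ₗ[ℂ] H₁)) (LinearMap.ker (S : H₁ →ₗ[ℂ] H₂))) ∧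
  FiniteDimensional ℂ (relQuot (LinearMap.ker (T : H₂ →ₗ[ℂ] H₁)) (LinearMap.range (S : H₁ →ₗ[ℂ] H₂))) ∧
  FiniteDimensional ℂ (relQuot (LinearMap.range (S : H₁ →ₗ[ℂ] H₂)) (LinearMap.ker (T : H₂ →ₗ[ℂ] H₁)))

/-- The index of a Fredholm pair:
`ind (S,T) = dim N(S)/(N(S)⊓R(T)) - dim R(T)/(N(S)⊓R(T)) - dim N(T)/(N(T)⊓R(S)) + dim R(S)/(N(T)⊓R(S))`. -/
def pairIndex (S : H₁ →L[ℂ] H₂) (T : H₂ →L[ℂ] H₁) : ℤ :=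
  (finrank ℂ (relQuot (LinearMap.ker (S : H₁ →ₗ[ℂ] H₂)) (LinearMap.range (T : H₂ →ₗ[ℂ] H₁))) : ℤ)
    - (finrank ℂ (relQuot (LinearMap.range (T : H₂ →ₗ[ℂ] H₁)) (LinearMap.ker (S : H₁ →ₗ[ℂ] H₂))) : ℤ)
    - (finrank ℂ (relQuot (LinearMap.ker (T : H₂ →ₗ[ℂ] H₁)) (LinearMap.range (S : H₁ →ₗ[ℂ] H₂))) : ℤ)
    + (finrank ℂ (relQuot (LinearMap.range (S : H₁ →ₗ[ℂ] H₂)) (LinearMap.ker (T : H₂ →ₗ[ℂ] H₁))) : ℤ)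

/-- A bounded operator is Fredholm if its kernel is finite dimensional, its range is closed
and its cokernel is finite dimensional. -/
def IsFredholmOp (A : H₁ →L[ℂ] H₂) : Prop :=
  FiniteDimensional ℂ (LinearMap.ker (A : H₁ →ₗ[ℂ] H₂)) ∧ IsClosed (LinearMap.range (A : H₁ →ₗ[ℂ] H₂) : Set H₂) ∧
  FiniteDimensional ℂ (H₂ ⧸ LinearMap.range (A : H₁ →ₗ[ℂ] H₂))

/-- The index of a Fredholm operator: `ind A = dim N(A) - dim H₂/R(A)`. -/
def opIndex (A : H₁ →L[ℂ] H₂) : ℤ :=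
  (finrank ℂ (LinearMap.ker (A : H₁ →ₗ[ℂ] H₂)) : ℤ) - (finrank ℂ (H₂ ⧸ LinearMap.range (A : H₁ →ₗ[ℂ] H₂)) : ℤ)

end Defs

variable {H₁ H₂ : Type*} [NormedAddCommGroup H₁] [InnerProductSpace ℂ H₁] [CompleteSpace H₁]
  [NormedAddCommGroup H₂] [InnerProductSpace ℂ H₂] [CompleteSpace H₂]

/-- Over Hilbert spaces, closedness of the range is automatic in the definition of a Fredholm
operator, and finite codimension can be tested with any finite-dimensional supplement. -/
theorem isFredholmOp_iff_fg {E F : Type*} [NormedAddCommGroup E] [InnerProductSpace ℂ E]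
    [CompleteSpace E] [NormedAddCommGroup F] [NormedSpace ℂ F] [CompleteSpace F]
    (A : E →L[ℂ] F) :
    IsFredholmOp A ↔ (LinearMap.ker (A : E →ₗ[ℂ] F)).FG ∧
      ∃ C : Submodule ℂ F, C.FG ∧ LinearMap.range (A : E →ₗ[ℂ] F) ⊔ C = ⊤ := by
  constructor
  · rintro ⟨hker, -, hcoker⟩
    obtain ⟨C, hC⟩ := Submodule.exists_isCompl (LinearMap.range (A : E →ₗ[ℂ] F))
    exact ⟨Module.Finite.iff_fg.mp hker, C, Submodule.CoFG.fg_of_isCompl hC hcoker, hC.sup_eq_top⟩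
  · rintro ⟨hker, C, hC, hsup⟩
    have hcoker : (LinearMap.range (A : E →ₗ[ℂ] F)).CoFG :=
      hC.cofg_of_codisjoint (codisjoint_iff.mpr hsup).symm
    refine ⟨Module.Finite.iff_fg.mpr hker, ?_, hcoker⟩
    obtain ⟨G, hG⟩ := Submodule.exists_isCompl (LinearMap.range (A : E →ₗ[ℂ] F))
    have : FiniteDimensional ℂ G := Module.Finite.iff_fg.mpr (hcoker.fg_of_isCompl hG)
    set K : Submodule ℂ E := LinearMap.ker (A : E →ₗ[ℂ] F)
    have : FiniteDimensional ℂ K := Module.Finite.iff_fg.mpr hker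
    let f : Kᗮ →L[ℂ] F := A ∘L Kᗮ.subtypeL
    have hrange : LinearMap.range (f : Kᗮ →ₗ[ℂ] F) = LinearMap.range (A : E →ₗ[ℂ] F) := by
      refine le_antisymm (by rintro _ ⟨x, rfl⟩; exact ⟨x, rfl⟩) ?_
      rintro _ ⟨x, rfl⟩
      obtain ⟨y, hy, z, hz, rfl⟩ := K.exists_add_mem_mem_orthogonal x
      have hy0 : A y = 0 := hy
      exact ⟨⟨z, hz⟩, by simp [f, hy0]⟩
    have hinj : LinearMap.ker (f : Kᗮ →ₗ[ℂ] F) = ⊥ := by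
      rw [LinearMap.ker_eq_bot']
      rintro ⟨z, hz⟩ hfz
      have hzK : z ∈ K := hfz
      exact Subtype.ext (Submodule.disjoint_def.mp K.orthogonal_disjoint z hzK hz)
    rw [← hrange]
    exact closed_complemented_range_of_isCompl_of_ker_eq_bot f G (hrange ▸ hG)
      G.closed_of_finiteDimensional hinj

/-- The square of an operator is Fredholm exactly when the operator is. -/
theorem isFredholmOp_comp_self_iff {E : Type*} [NormedAddCommGroup E] [InnerProductSpace ℂ E]
    [CompleteSpace E] (A : E →L[ℂ] E) : IsFredholmOp (A ∘L A) ↔ IsFredholmOp A := by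
  simp only [isFredholmOp_iff_fg]
  constructor
  · rintro ⟨hker, C, hC, hsup⟩
    refine ⟨hker.of_le (LinearMap.ker_le_ker_comp _ _), C, hC, top_le_iff.mp ?_⟩
    rw [← hsup]
    exact sup_le_sup_right (LinearMap.range_comp_le_range _ _) C
  · rintro ⟨hker, C, hC, hsup⟩
    refine ⟨Submodule.fg_of_fg_map_of_fg_inf_ker (A : E →ₗ[ℂ] E) (hker.of_le ?_)
      (hker.of_le inf_le_right), C.map (A : E →ₗ[ℂ] E) ⊔ C, (hC.map _).sup hC, ?_⟩
    · rintro _ ⟨x, hx, rfl⟩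
      exact hx
    · rw [ContinuousLinearMap.toLinearMap_comp, LinearMap.range_comp, ← sup_assoc,
        ← Submodule.map_sup, hsup, Submodule.map_top, hsup]

/-- Fredholmness is stable under finite-rank perturbations. -/
theorem IsFredholmOp.add_of_fg_range {E F : Type*} [NormedAddCommGroup E] [InnerProductSpace ℂ E]
    [CompleteSpace E] [NormedAddCommGroup F] [NormedSpace ℂ F] [CompleteSpace F]
    {A K : E →L[ℂ] F} (hA : IsFredholmOp A) (hK : (LinearMap.range (K : E →ₗ[ℂ] F)).FG) :
    IsFredholmOp (A + K) := by
  rw [isFredholmOp_iff_fg] at hA ⊢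
  obtain ⟨hker, C, hC, hsup⟩ := hA
  refine ⟨Submodule.fg_of_fg_map_of_fg_inf_ker (K : E →ₗ[ℂ] F) (hK.of_le LinearMap.map_le_range)
    (hker.of_le ?_), _, hK.sup hC, top_le_iff.mp ?_⟩
  · rintro x ⟨hx, hKx⟩
    have hx' : A x + K x = 0 := hx
    have hKx' : K x = 0 := hKx
    rwa [hKx', add_zero] at hx'
  · rw [← hsup, ← sup_assoc]
    refine sup_le_sup_right ?_ C
    rintro _ ⟨x, rfl⟩
    exact Submodule.mem_sup.mpr ⟨(A + K) x, ⟨x, rfl⟩, -K x, neg_mem ⟨x, rfl⟩, by simp⟩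

theorem isFredholmOp_add_iff_of_fg_range {E F : Type*} [NormedAddCommGroup E]
    [InnerProductSpace ℂ E] [CompleteSpace E] [NormedAddCommGroup F] [NormedSpace ℂ F]
    [CompleteSpace F] {A K : E →L[ℂ] F} (hK : (LinearMap.range (K : E →ₗ[ℂ] F)).FG) :
    IsFredholmOp (A + K) ↔ IsFredholmOp A := by
  refine ⟨fun h ↦ ?_, fun h ↦ h.add_of_fg_range hK⟩
  have hneg : (LinearMap.range ((-K : E →L[ℂ] F) : E →ₗ[ℂ] F)).FG := by
    rwa [ContinuousLinearMap.toLinearMap_neg, LinearMap.range_neg]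
  simpa using h.add_of_fg_range hneg

/-- The adjoint of a finite-rank operator has finite rank. -/
theorem fg_range_adjoint {E F : Type*} [NormedAddCommGroup E] [InnerProductSpace ℂ E]
    [CompleteSpace E] [NormedAddCommGroup F] [InnerProductSpace ℂ F] [CompleteSpace F]
    {K : E →L[ℂ] F} (hK : (LinearMap.range (K : E →ₗ[ℂ] F)).FG) :
    (LinearMap.range (adjoint K : F →ₗ[ℂ] E)).FG := by
  have : FiniteDimensional ℂ (LinearMap.range (K : E →ₗ[ℂ] F)) := Module.Finite.iff_fg.mpr hK
  refine (hK.map (adjoint K : F →ₗ[ℂ] E)).of_le ?_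
  rintro _ ⟨x, rfl⟩
  obtain ⟨y, hy, z, hz, rfl⟩ :=
    (LinearMap.range (K : E →ₗ[ℂ] F)).exists_add_mem_mem_orthogonal x
  have hz0 : adjoint K z = 0 := by
    refine ext_inner_left ℂ fun w ↦ ?_
    rw [adjoint_inner_right, inner_zero_right]
    exact hz _ ⟨w, rfl⟩
  exact ⟨y, hy, by simp [hz0]⟩

/-- A block-diagonal operator is Fredholm exactly when both diagonal blocks are. -/
theorem isFredholmOp_iff_of_blockDiagonal {E F : Type*} [NormedAddCommGroup E]
    [InnerProductSpace ℂ E] [CompleteSpace E] [NormedAddCommGroup F] [InnerProductSpace ℂ F]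
    [CompleteSpace F] {W : WithLp 2 (E × F) →L[ℂ] WithLp 2 (E × F)} {A : E →L[ℂ] E}
    {B : F →L[ℂ] F} (hW : ∀ x y, W (WithLp.toLp 2 (x, y)) = WithLp.toLp 2 (A x, B y)) :
    IsFredholmOp W ↔ IsFredholmOp A ∧ IsFredholmOp B := by
  let e := WithLp.linearEquiv 2 ℂ (E × F)
  have hW' : (W : WithLp 2 (E × F) →ₗ[ℂ] WithLp 2 (E × F)) =
      (e.symm : E × F →ₗ[ℂ] WithLp 2 (E × F)) ∘ₗ
        ((A : E →ₗ[ℂ] E).prodMap (B : F →ₗ[ℂ] F)) ∘ₗ (e : WithLp 2 (E × F) →ₗ[ℂ] E × F) :=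
    LinearMap.ext fun z ↦ hW z.fst z.snd
  have hker : (LinearMap.ker (W : WithLp 2 (E × F) →ₗ[ℂ] WithLp 2 (E × F))).map
      (e : WithLp 2 (E × F) →ₗ[ℂ] E × F) =
      (LinearMap.ker (A : E →ₗ[ℂ] E)).prod (LinearMap.ker (B : F →ₗ[ℂ] F)) := by
    rw [hW', LinearEquiv.ker_comp, LinearMap.ker_comp, LinearMap.ker_prodMap,
      Submodule.map_comap_eq_of_surjective e.surjective]
  have hrange : (LinearMap.range (W : WithLp 2 (E × F) →ₗ[ℂ] WithLp 2 (E × F))).map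
      (e : WithLp 2 (E × F) →ₗ[ℂ] E × F) =
      (LinearMap.range (A : E →ₗ[ℂ] E)).prod (LinearMap.range (B : F →ₗ[ℂ] F)) := by
    rw [hW', ← LinearMap.range_comp, ← LinearMap.range_prodMap, ← LinearMap.comp_assoc,
      LinearEquiv.comp_coe, LinearEquiv.symm_trans_self, LinearEquiv.refl_toLinearMap,
      LinearMap.id_comp, LinearMap.range_comp_of_range_eq_top _ e.range]
  simp only [isFredholmOp_iff_fg]
  constructor
  · rintro ⟨hk, C, hC, hsup⟩
    have hk' := hk.map (e : WithLp 2 (E × F) →ₗ[ℂ] E × F)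
    have hsup' := congrArg (Submodule.map (e : WithLp 2 (E × F) →ₗ[ℂ] E × F)) hsup
    have hC' := hC.map (e : WithLp 2 (E × F) →ₗ[ℂ] E × F)
    rw [hker] at hk'
    rw [Submodule.map_sup, hrange, Submodule.map_top, e.range] at hsup'
    refine ⟨⟨?_, _, hC'.map (LinearMap.fst ℂ E F), ?_⟩, ?_, _, hC'.map (LinearMap.snd ℂ E F), ?_⟩
    · simpa only [Submodule.prod_map_fst] using hk'.map (LinearMap.fst ℂ E F)
    · simpa only [Submodule.map_sup, Submodule.prod_map_fst, Submodule.map_top,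
        Submodule.range_fst] using congrArg (Submodule.map (LinearMap.fst ℂ E F)) hsup'
    · simpa only [Submodule.prod_map_snd] using hk'.map (LinearMap.snd ℂ E F)
    · simpa only [Submodule.map_sup, Submodule.prod_map_snd, Submodule.map_top,
        Submodule.range_snd] using congrArg (Submodule.map (LinearMap.snd ℂ E F)) hsup'
  · rintro ⟨⟨hkA, C, hC, hsupC⟩, hkB, D, hD, hsupD⟩
    refine ⟨Submodule.fg_of_fg_map_injective _ e.injective (hker ▸ hkA.prod hkB),
      (C.prod D).map (e.symm : E × F →ₗ[ℂ] WithLp 2 (E × F)), (hC.prod hD).map _, ?_⟩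
    apply Submodule.map_injective_of_injective e.injective
    rw [Submodule.map_sup, hrange, ← Submodule.map_comp, LinearEquiv.comp_coe,
      LinearEquiv.symm_trans_self, LinearEquiv.refl_toLinearMap, Submodule.map_id,
      Submodule.prod_sup_prod, hsupC, hsupD, Submodule.prod_top, Submodule.map_top, e.range]

theorem fredholm_selfadjoint_tfae (S : H₁ →L[ℂ] H₂) (T : H₂ →L[ℂ] H₁)
    (hTS : FiniteDimensional ℂ (LinearMap.range (T ∘L S : H₁ →ₗ[ℂ] H₁)))
    (hST : FiniteDimensional ℂ (LinearMap.range (S ∘L T : H₂ →ₗ[ℂ] H₂)))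
    (U : WithLp 2 (H₁ × H₂) →L[ℂ] WithLp 2 (H₁ × H₂))
    (hU : ∀ z : WithLp 2 (H₁ × H₂),
      WithLp.equiv 2 (H₁ × H₂) (U z) =
        (T (WithLp.equiv 2 (H₁ × H₂) z).2, S (WithLp.equiv 2 (H₁ × H₂) z).1)) :
    [IsFredholmOp (U + adjoint U),
     IsFredholmOp ((U + adjoint U) ∘L (U + adjoint U)),
     IsFredholmOp ((U ∘L adjoint U) + (adjoint U ∘L U)),
     IsFredholmOp ((T ∘L adjoint T) + (adjoint S ∘L S)) ∧
       IsFredholmOp ((S ∘L adjoint S) + (adjoint T ∘L T))].TFAE := by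
  have hUtoLp (x : H₁) (y : H₂) : U (WithLp.toLp 2 (x, y)) = WithLp.toLp 2 (T y, S x) :=
    (WithLp.equiv 2 (H₁ × H₂)).injective (hU _)
  have hUadj (x : H₁) (y : H₂) :
      adjoint U (WithLp.toLp 2 (x, y)) = WithLp.toLp 2 (adjoint S y, adjoint T x) := by
    refine ext_inner_left ℂ fun w ↦ ?_
    obtain ⟨a, b⟩ := w
    rw [adjoint_inner_right, hUtoLp]
    simp only [WithLp.prod_inner_apply, adjoint_inner_right]
    exact add_comm _ _
  have hUU : (LinearMap.range (U ∘L U : WithLp 2 (H₁ × H₂) →ₗ[ℂ] WithLp 2 (H₁ × H₂))).FG := by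
    refine (((Module.Finite.iff_fg.mp hTS).prod (Module.Finite.iff_fg.mp hST)).map
      ((WithLp.linearEquiv 2 ℂ (H₁ × H₂)).symm :
        H₁ × H₂ →ₗ[ℂ] WithLp 2 (H₁ × H₂))).of_le ?_
    rintro _ ⟨⟨x, y⟩, rfl⟩
    refine ⟨(T (S x), S (T y)), ⟨⟨x, rfl⟩, ⟨y, rfl⟩⟩, ?_⟩
    change _ = U (U _)
    rw [hUtoLp, hUtoLp]
    rfl
  have hsq : (U + adjoint U) ∘L (U + adjoint U) =
      ((U ∘L adjoint U) + (adjoint U ∘L U)) + (U ∘L U) + adjoint (U ∘L U) := by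
    rw [adjoint_comp, add_comp, comp_add, comp_add]
    abel
  tfae_have 2 ↔ 1 := isFredholmOp_comp_self_iff _
  tfae_have 2 ↔ 3 := by
    rw [hsq, isFredholmOp_add_iff_of_fg_range (fg_range_adjoint hUU),
      isFredholmOp_add_iff_of_fg_range hUU]
  tfae_have 3 ↔ 4 := isFredholmOp_iff_of_blockDiagonal fun x y ↦ by
    simp only [add_apply, comp_apply, hUtoLp, hUadj, ← WithLp.toLp_add, Prod.mk_add_mk]
  tfae_finish
end
end

section
/- Let H be a Hilbert space and T ∈ L(H) an operator such that T² = 0 and R(T) is closed. Then the quotient N(T)/R(T) is finite-dimensional if and only if the self-adjoint operator T + T* is a Fredholm operator on H. -/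
open Module ContinuousLinearMap

noncomputable section

set_option maxHeartbeats 1000000
set_option synthInstance.maxHeartbeats 1000000

section ClosedRange

variable {E F : Type*} [NormedAddCommGroup E] [InnerProductSpace ℂ E] [CompleteSpace E]
  [NormedAddCommGroup F] [InnerProductSpace ℂ F] [CompleteSpace F]

/-- The adjoint of an operator with closed range is bounded below on that range. -/
lemma exists_norm_le_mul_norm_adjoint (T : E →L[ℂ] F)
    (hT : IsClosed (LinearMap.range (T : E →ₗ[ℂ] F) : Set F)) :
    ∃ C > 0, ∀ y ∈ LinearMap.range (T : E →ₗ[ℂ] F), ‖y‖ ≤ C * ‖adjoint T y‖ := by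
  have : CompleteSpace (LinearMap.range (T : E →ₗ[ℂ] F)) := hT.completeSpace_coe
  obtain ⟨C, hC, h⟩ := exists_preimage_norm_le
    (T.codRestrict (LinearMap.range (T : E →ₗ[ℂ] F)) fun x => ⟨x, rfl⟩) (by
      rintro ⟨_, x, rfl⟩
      exact ⟨x, rfl⟩)
  refine ⟨C, hC, fun y hy => ?_⟩
  obtain ⟨x, hx, hxC⟩ := h ⟨y, hy⟩
  replace hx : T x = y := congrArg Subtype.val hx
  replace hxC : ‖x‖ ≤ C * ‖y‖ := hxC
  rcases (norm_nonneg y).eq_or_lt with h0 | h0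
  · rw [← h0]
    positivity
  refine le_of_mul_le_mul_right ?_ h0
  calc ‖y‖ * ‖y‖ = ‖inner ℂ y y‖ := by simp [inner_self_eq_norm_sq_to_K, sq]
    _ = ‖inner ℂ x (adjoint T y)‖ := by rw [adjoint_inner_right, hx]
    _ ≤ ‖x‖ * ‖adjoint T y‖ := norm_inner_le_norm _ _
    _ ≤ C * ‖y‖ * ‖adjoint T y‖ := by gcongr
    _ = C * ‖adjoint T y‖ * ‖y‖ := by ring

/-- The adjoint of an operator with closed range has closed range. -/
lemma isClosed_range_adjoint (T : E →L[ℂ] F)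
    (hT : IsClosed (LinearMap.range (T : E →ₗ[ℂ] F) : Set F)) :
    IsClosed (LinearMap.range (adjoint T : F →ₗ[ℂ] E) : Set E) := by
  have : CompleteSpace (LinearMap.range (T : E →ₗ[ℂ] F)) := hT.completeSpace_coe
  obtain ⟨C, hC, h⟩ := exists_norm_le_mul_norm_adjoint T hT
  set f := adjoint T ∘L (LinearMap.range (T : E →ₗ[ℂ] F)).subtypeL
  have hf : AntilipschitzWith C.toNNReal f := by
    refine f.antilipschitz_of_bound fun y => ?_
    rw [Real.coe_toNNReal C hC.le]
    exact h y y.2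
  have hr : (LinearMap.range (adjoint T : F →ₗ[ℂ] E) : Set E) = Set.range f := by
    ext z
    constructor
    · rintro ⟨x, rfl⟩
      obtain ⟨y, hy, w, hw, rfl⟩ :=
        (LinearMap.range (T : E →ₗ[ℂ] F)).exists_add_mem_mem_orthogonal x
      rw [orthogonal_range] at hw
      exact ⟨⟨y, hy⟩, by simpa [f] using hw⟩
    · rintro ⟨y, rfl⟩
      exact ⟨y, rfl⟩
  rw [hr]
  exact hf.isClosed_range f.uniformContinuous

/-- The orthogonal complement of the kernel of an operator with closed range is the range of its
adjoint. -/
lemma orthogonal_ker_eq_range_adjoint (T : E →L[ℂ] F)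
    (hT : IsClosed (LinearMap.range (T : E →ₗ[ℂ] F) : Set F)) :
    (LinearMap.ker (T : E →ₗ[ℂ] F))ᗮ = LinearMap.range (adjoint T : F →ₗ[ℂ] E) :=
  (orthogonal_ker T).trans (isClosed_range_adjoint T hT).submodule_topologicalClosure_eq

end ClosedRange

section SquareZero

variable {H : Type*} [NormedAddCommGroup H] [InnerProductSpace ℂ H] [CompleteSpace H]
  {T : H →L[ℂ] H}

lemma adjoint_comp_adjoint_eq_zero (hT2 : T ∘L T = 0) : adjoint T ∘L adjoint T = 0 := by
  rw [← adjoint_comp, hT2, map_zero]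

lemma mem_ker_add_adjoint_iff (hT2 : T ∘L T = 0) (x : H) :
    x ∈ LinearMap.ker ((T + adjoint T : H →L[ℂ] H) : H →ₗ[ℂ] H) ↔ T x = 0 ∧ adjoint T x = 0 := by
  constructor
  · intro hx
    replace hx : T x + adjoint T x = 0 := hx
    have h0 : inner ℂ (T x) (adjoint T x) = 0 := by
      rw [adjoint_inner_right, show T (T x) = 0 from DFunLike.congr_fun hT2 x, inner_zero_left]
    have h1 : T x = 0 := by
      rw [← inner_self_eq_zero (𝕜 := ℂ)]
      calc inner ℂ (T x) (T x) = inner ℂ (T x) (T x + adjoint T x) := by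
            rw [inner_add_right, h0, add_zero]
        _ = 0 := by rw [hx, inner_zero_right]
    exact ⟨h1, by simpa [h1] using hx⟩
  · rintro ⟨h1, h2⟩
    simp [h1, h2]

lemma range_adjoint_le_range_add_adjoint (hT2 : T ∘L T = 0)
    (hT : IsClosed (LinearMap.range (T : H →ₗ[ℂ] H) : Set H)) :
    LinearMap.range (adjoint T : H →ₗ[ℂ] H) ≤
      LinearMap.range ((T + adjoint T : H →L[ℂ] H) : H →ₗ[ℂ] H) := by
  have : CompleteSpace (LinearMap.range (T : H →ₗ[ℂ] H)) := hT.completeSpace_coe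
  rintro _ ⟨x, rfl⟩
  obtain ⟨_, ⟨y, rfl⟩, w, hw, rfl⟩ :=
    (LinearMap.range (T : H →ₗ[ℂ] H)).exists_add_mem_mem_orthogonal x
  rw [orthogonal_range] at hw
  replace hw : adjoint T w = 0 := hw
  have h0 : T (T y) = 0 := DFunLike.congr_fun hT2 y
  exact ⟨T y, by simp [h0, hw]⟩

lemma range_le_range_add_adjoint (hT2 : T ∘L T = 0)
    (hT : IsClosed (LinearMap.range (T : H →ₗ[ℂ] H) : Set H)) :
    LinearMap.range (T : H →ₗ[ℂ] H) ≤
      LinearMap.range ((T + adjoint T : H →L[ℂ] H) : H →ₗ[ℂ] H) := by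
  simpa [add_comm] using range_adjoint_le_range_add_adjoint (T := adjoint T)
    (adjoint_comp_adjoint_eq_zero hT2) (isClosed_range_adjoint T hT)

lemma exists_add_mem_ker_add_adjoint (hT2 : T ∘L T = 0)
    (hT : IsClosed (LinearMap.range (T : H →ₗ[ℂ] H) : Set H)) {x : H} (hx : T x = 0) :
    ∃ y, ∃ k ∈ LinearMap.ker ((T + adjoint T : H →L[ℂ] H) : H →ₗ[ℂ] H), x = T y + k := by
  have : CompleteSpace (LinearMap.range (T : H →ₗ[ℂ] H)) := hT.completeSpace_coe
  obtain ⟨_, ⟨y, rfl⟩, k, hk, rfl⟩ :=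
    (LinearMap.range (T : H →ₗ[ℂ] H)).exists_add_mem_mem_orthogonal x
  rw [orthogonal_range] at hk
  have h0 : T (T y) = 0 := DFunLike.congr_fun hT2 y
  exact ⟨y, k, (mem_ker_add_adjoint_iff hT2 k).2 ⟨by simpa [h0] using hx, hk⟩, rfl⟩

lemma range_add_adjoint_eq_orthogonal_ker (hT2 : T ∘L T = 0)
    (hT : IsClosed (LinearMap.range (T : H →ₗ[ℂ] H) : Set H)) :
    LinearMap.range ((T + adjoint T : H →L[ℂ] H) : H →ₗ[ℂ] H) =
      (LinearMap.ker ((T + adjoint T : H →L[ℂ] H) : H →ₗ[ℂ] H))ᗮ := by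
  have : CompleteSpace (LinearMap.range (T : H →ₗ[ℂ] H)) := hT.completeSpace_coe
  apply le_antisymm
  · rw [orthogonal_ker, map_add, adjoint_adjoint, add_comm (adjoint T)]
    exact Submodule.le_topologicalClosure _
  · intro v hv
    obtain ⟨_, ⟨x, rfl⟩, w, hw, rfl⟩ :=
      (LinearMap.range (T : H →ₗ[ℂ] H)).exists_add_mem_mem_orthogonal v
    refine add_mem (range_le_range_add_adjoint hT2 hT ⟨x, rfl⟩)
      (range_adjoint_le_range_add_adjoint hT2 hT ?_)
    rw [← orthogonal_ker_eq_range_adjoint T hT, Submodule.mem_orthogonal]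
    intro u hu
    obtain ⟨y, k, hk, rfl⟩ := exists_add_mem_ker_add_adjoint hT2 hT hu
    have hkv := (Submodule.mem_orthogonal _ _).1 hv k hk
    have hkx : inner ℂ k (T x) = 0 := by
      rw [← adjoint_inner_left, ((mem_ker_add_adjoint_iff hT2 k).1 hk).2, inner_zero_left]
    have hyw : inner ℂ (T y) w = 0 := (Submodule.mem_orthogonal _ _).1 hw _ ⟨y, rfl⟩
    rw [inner_add_right] at hkv
    simp only [coe_coe, hkx, zero_add] at hkv
    rw [inner_add_left, hyw, hkv, add_zero]

/-- Hodge-type isomorphism: every class in `N(T)/R(T)` has a unique representative in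
`N(T + T*)`. -/
def kerAddAdjointEquiv (hT2 : T ∘L T = 0)
    (hT : IsClosed (LinearMap.range (T : H →ₗ[ℂ] H) : Set H)) :
    LinearMap.ker ((T + adjoint T : H →L[ℂ] H) : H →ₗ[ℂ] H) ≃ₗ[ℂ]
      relQuot (LinearMap.ker (T : H →ₗ[ℂ] H)) (LinearMap.range (T : H →ₗ[ℂ] H)) :=
  LinearEquiv.ofBijective
    (Submodule.mkQ _ ∘ₗ Submodule.inclusion
      fun x hx => ((mem_ker_add_adjoint_iff hT2 x).1 hx).1) <| by
    constructor
    · rw [injective_iff_map_eq_zero]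
      rintro ⟨k, hk⟩ h
      obtain ⟨-, y, hy⟩ := (Submodule.Quotient.mk_eq_zero _).1 h
      replace hy : T y = k := hy
      have hk' := ((mem_ker_add_adjoint_iff hT2 k).1 hk).2
      ext
      change k = 0
      rw [← inner_self_eq_zero (𝕜 := ℂ)]
      nth_rewrite 1 [← hy]
      rw [← adjoint_inner_right, hk', inner_zero_right]
    · intro q
      obtain ⟨⟨x, hx⟩, rfl⟩ := Submodule.mkQ_surjective _ q
      obtain ⟨y, k, hk, rfl⟩ := exists_add_mem_ker_add_adjoint hT2 hT hx
      refine ⟨⟨k, hk⟩, (Submodule.Quotient.eq _).2 ⟨Submodule.sub_mem _ ?_ hx, -y, ?_⟩⟩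
      · exact ((mem_ker_add_adjoint_iff hT2 k).1 hk).1
      · change T (-y) = k - (T y + k)
        rw [map_neg]
        abel

end SquareZero

theorem quotient_finite_iff_fredholm_selfadjoint {H : Type*} [NormedAddCommGroup H]
    [InnerProductSpace ℂ H] [CompleteSpace H] (T : H →L[ℂ] H)
    (hT2 : T ∘L T = 0) (hclosed : IsClosed (LinearMap.range (T : H →ₗ[ℂ] H) : Set H)) :
    FiniteDimensional ℂ (relQuot (LinearMap.ker (T : H →ₗ[ℂ] H)) (LinearMap.range (T : H →ₗ[ℂ] H))) ↔
      IsFredholmOp (T + ContinuousLinearMap.adjoint T) := by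
  have e := kerAddAdjointEquiv hT2 hclosed
  constructor
  · intro h
    have hfin := e.symm.finiteDimensional
    refine ⟨hfin, ?_, ?_⟩
    · rw [range_add_adjoint_eq_orthogonal_ker hT2 hclosed]
      exact Submodule.isClosed_orthogonal _
    · rw [range_add_adjoint_eq_orthogonal_ker hT2 hclosed]
      exact (Submodule.quotientEquivOfIsCompl _ _
        (Submodule.isCompl_orthogonal _).symm).symm.finiteDimensional
  · rintro ⟨h, -, -⟩
    exact e.finiteDimensional
end
end

section
/- Let H₁ and H₂ be Hilbert spaces and let S ∈ L(H₁,H₂) and T ∈ L(H₂,H₁) be such that R(TS) and R(ST) are finite-dimensional subspaces of H₁ and H₂ respectively. Then the following statements are equivalent: (i) (S,T) is a Fredholm pair; (ii) S + T* ∈ L(H₁,H₂) is a Fredholm operator; (iii) T + S* ∈ L(H₂,H₁) is a Fredholm operator. Furthermore, in this case ind(S,T) = ind(S + T*) = − ind(T + S*). -/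
open Module ContinuousLinearMap

noncomputable section

set_option maxHeartbeats 1000000
set_option synthInstance.maxHeartbeats 1000000

section Algebra

variable {E F G : Type*} [AddCommGroup E] [Module ℂ E] [AddCommGroup F] [Module ℂ F]
  [AddCommGroup G] [Module ℂ G]

lemma Submodule.CoFG.of_sup_fg {p q : Submodule ℂ E} (h : (p ⊔ q).CoFG) (hq : q.FG) :
    p.CoFG := by
  obtain ⟨r, hr⟩ := (p ⊔ q).exists_isCompl
  have hqr : (q ⊔ r).FG := hq.sup (h.fg_of_isCompl hr)
  have : FiniteDimensional ℂ ↥(q ⊔ r) := Module.Finite.iff_fg.mpr hqr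
  refine Module.Finite.of_surjective (p.mkQ ∘ₗ (q ⊔ r).subtype) ?_
  rw [← LinearMap.range_eq_top, LinearMap.range_comp, Submodule.range_subtype,
    Submodule.map_mkQ_eq_top, ← sup_assoc]
  exact hr.sup_eq_top

/-- Finite-dimensionality of the kernel and the cokernel passes to finite rank perturbations. -/
lemma finite_ker_coker_of_finite_range_sub {A B : E →ₗ[ℂ] F} (hAB : (LinearMap.range (A - B)).FG)
    (hk : FiniteDimensional ℂ (LinearMap.ker A)) (hc : (LinearMap.range A).CoFG) :
    FiniteDimensional ℂ (LinearMap.ker B) ∧ (LinearMap.range B).CoFG := by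
  have := Module.Finite.iff_fg.mpr hAB
  constructor
  · refine Module.Finite.iff_fg.mpr (Submodule.fg_of_fg_map_of_fg_inf_ker A ?_ ?_)
    · refine Submodule.FG.of_le hAB ?_
      rintro _ ⟨x, hx, rfl⟩
      exact ⟨x, by simp_all⟩
    · exact Submodule.FG.of_le (Module.Finite.iff_fg.mp hk) inf_le_right
  · refine Submodule.CoFG.of_sup_fg (hc.of_le ?_) hAB
    rintro _ ⟨x, rfl⟩
    exact Submodule.mem_sup.mpr ⟨B x, ⟨x, rfl⟩, (A - B) x, ⟨x, rfl⟩, by simp⟩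

/-- The index is invariant under finite rank perturbations. -/
lemma LinearMap.index_eq_of_finite_range_sub {A B : E →ₗ[ℂ] F}
    (hAB : (LinearMap.range (A - B)).FG)
    (hk : FiniteDimensional ℂ (LinearMap.ker A)) (hc : (LinearMap.range A).CoFG) :
    A.index = B.index := by
  obtain ⟨hk', hc'⟩ := finite_ker_coker_of_finite_range_sub hAB hk hc
  let ι := (LinearMap.ker (A - B)).subtype
  have hι : ι = (LinearMap.ker (A - B)).subtype := rfl
  have hcomp : A ∘ₗ ι = B ∘ₗ ι := by
    ext ⟨x, hx⟩
    simpa [ι, sub_eq_zero] using hx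
  have : FiniteDimensional ℂ (LinearMap.ker ι) := by
    rw [hι, Submodule.ker_subtype]; infer_instance
  have : FiniteDimensional ℂ (E ⧸ LinearMap.range ι) := by
    rw [hι, Submodule.range_subtype]; exact Submodule.range_fg_iff_ker_cofg.mp hAB
  have hA := LinearMap.index_comp (f := ι) A
  have hB := LinearMap.index_comp (f := ι) B
  rw [hcomp] at hA
  linarith

/-- If `p ⊓ q = p ⊓ ker f`, then `p / (p ⊓ q)` is isomorphic to the image of `p` under `f`. -/
def relQuotEquivMap (f : E →ₗ[ℂ] F) {p q : Submodule ℂ E} (h : p ⊓ q = p ⊓ LinearMap.ker f) :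
    relQuot p q ≃ₗ[ℂ] p.map f :=
  (Submodule.quotEquivOfEq _ _ (by
      rw [h, LinearMap.ker_domRestrict, Submodule.comap_inf, Submodule.comap_subtype_self,
        top_inf_eq])).trans
    ((f.domRestrict p).quotKerEquivRange.trans
      (LinearEquiv.ofEq _ _ (LinearMap.range_domRestrict _ _)))

/-- Dimensions of relative quotients are additive along a chain `d ≤ p ≤ q`. -/
lemma relQuot_tower {d p q : Submodule ℂ E} (hdp : d ≤ p) (hpq : p ≤ q)
    (hfin : FiniteDimensional ℂ (relQuot q p)) :
    (FiniteDimensional ℂ (relQuot q d) ↔ FiniteDimensional ℂ (relQuot p d)) ∧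
    (FiniteDimensional ℂ (relQuot p d) →
      finrank ℂ (relQuot q d) = finrank ℂ (relQuot q p) + finrank ℂ (relQuot p d)) := by
  set P := p.map d.mkQ
  set Q := q.map d.mkQ
  set g : (E ⧸ d) →ₗ[ℂ] (E ⧸ p) := d.mapQ p LinearMap.id hdp
  have hg : LinearMap.ker g = P := by
    rw [Submodule.ker_mapQ, Submodule.comap_id]
  have hQ : Q.map g = q.map p.mkQ := by
    rw [← Submodule.map_comp]; rfl
  have hPQ : P ≤ Q := Submodule.map_mono hpq
  have eq_d : relQuot q d ≃ₗ[ℂ] Q := relQuotEquivMap d.mkQ (by rw [Submodule.ker_mkQ])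
  have ep_d : relQuot p d ≃ₗ[ℂ] P := relQuotEquivMap d.mkQ (by rw [Submodule.ker_mkQ])
  have eq_p : relQuot q p ≃ₗ[ℂ] LinearMap.range (g.domRestrict Q) :=
    (relQuotEquivMap p.mkQ (by rw [Submodule.ker_mkQ])).trans
      (LinearEquiv.ofEq _ _ (by rw [LinearMap.range_domRestrict, hQ]))
  have ek : LinearMap.ker (g.domRestrict Q) ≃ₗ[ℂ] P :=
    (LinearEquiv.ofEq _ _ (by rw [LinearMap.ker_domRestrict, hg])).trans
      (Submodule.comapSubtypeEquivOfLe hPQ)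
  have hQP : FiniteDimensional ℂ P → FiniteDimensional ℂ Q := fun hP => by
    refine Module.Finite.iff_fg.mpr (Submodule.fg_of_fg_map_of_fg_inf_ker g ?_ ?_)
    · rw [← LinearMap.range_domRestrict]
      exact Module.Finite.iff_fg.mp (Module.Finite.equiv eq_p)
    · exact Submodule.FG.of_le (Module.Finite.iff_fg.mp hP) (hg ▸ inf_le_right)
  refine ⟨⟨fun h => ?_, fun h => ?_⟩, fun h => ?_⟩
  · have : FiniteDimensional ℂ Q := Module.Finite.equiv eq_d
    have : FiniteDimensional ℂ P := Submodule.finiteDimensional_of_le hPQ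
    exact Module.Finite.equiv ep_d.symm
  · have := hQP (Module.Finite.equiv ep_d)
    exact Module.Finite.equiv eq_d.symm
  · have := hQP (Module.Finite.equiv ep_d)
    rw [eq_d.finrank_eq, ep_d.finrank_eq, eq_p.finrank_eq, ← ek.finrank_eq,
      LinearMap.finrank_range_add_finrank_ker]

end Algebra

section Hilbert

variable {H₁ H₂ : Type*} [NormedAddCommGroup H₁] [InnerProductSpace ℂ H₁]
  [NormedAddCommGroup H₂] [InnerProductSpace ℂ H₂]

lemma ContinuousLinearMap.ker_comp_subtypeL_orthogonal_ker (A : H₁ →L[ℂ] H₂) :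
    LinearMap.ker (A ∘L (LinearMap.ker (A : H₁ →ₗ[ℂ] H₂))ᗮ.subtypeL).toLinearMap = ⊥ := by
  rw [LinearMap.ker_eq_bot']
  rintro ⟨x, hx⟩ h
  have hxA : x ∈ LinearMap.ker (A : H₁ →ₗ[ℂ] H₂) := h
  exact Subtype.ext ((Submodule.orthogonal_disjoint _).le_bot ⟨hxA, hx⟩)

variable [CompleteSpace H₁]

lemma ContinuousLinearMap.map_starProjection_orthogonal_ker (A : H₁ →L[ℂ] H₂) (x : H₁) :
    A ((LinearMap.ker (A : H₁ →ₗ[ℂ] H₂))ᗮ.starProjection x) = A x := by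
  set N := LinearMap.ker (A : H₁ →ₗ[ℂ] H₂)
  have : CompleteSpace N := A.isClosed_ker.completeSpace_coe
  have h : x - Nᗮ.starProjection x ∈ N := by
    have := Nᗮ.sub_starProjection_mem_orthogonal x
    rwa [Submodule.orthogonal_orthogonal] at this
  have h' : A (x - Nᗮ.starProjection x) = 0 := h
  rw [map_sub, sub_eq_zero] at h'
  exact h'.symm

lemma ContinuousLinearMap.range_comp_subtypeL_orthogonal_ker (A : H₁ →L[ℂ] H₂) :
    LinearMap.range (A ∘L (LinearMap.ker (A : H₁ →ₗ[ℂ] H₂))ᗮ.subtypeL).toLinearMap =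
      LinearMap.range (A : H₁ →ₗ[ℂ] H₂) := by
  ext y
  constructor
  · rintro ⟨x, rfl⟩
    exact ⟨x, rfl⟩
  · rintro ⟨x, rfl⟩
    exact ⟨⟨_, Submodule.starProjection_apply_mem _ x⟩, A.map_starProjection_orthogonal_ker x⟩

variable [CompleteSpace H₂]

/-- A bounded operator whose range has finite codimension has closed range. -/
lemma ContinuousLinearMap.isClosed_range_of_coFG (A : H₁ →L[ℂ] H₂)
    (hc : (LinearMap.range (A : H₁ →ₗ[ℂ] H₂)).CoFG) :
    IsClosed (LinearMap.range (A : H₁ →ₗ[ℂ] H₂) : Set H₂) := by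
  obtain ⟨G, hG⟩ := (LinearMap.range (A : H₁ →ₗ[ℂ] H₂)).exists_isCompl
  have : FiniteDimensional ℂ G := Module.Finite.iff_fg.mpr (hc.fg_of_isCompl hG)
  rw [← A.range_comp_subtypeL_orthogonal_ker] at hG ⊢
  exact closed_complemented_range_of_isCompl_of_ker_eq_bot _ G hG G.closed_of_finiteDimensional
    A.ker_comp_subtypeL_orthogonal_ker

lemma isFredholmOp_iff (A : H₁ →L[ℂ] H₂) :
    IsFredholmOp A ↔ FiniteDimensional ℂ (LinearMap.ker (A : H₁ →ₗ[ℂ] H₂)) ∧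
      (LinearMap.range (A : H₁ →ₗ[ℂ] H₂)).CoFG :=
  ⟨fun h => ⟨h.1, h.2.2⟩, fun h => ⟨h.1, A.isClosed_range_of_coFG h.2, h.2⟩⟩

/-- If `A` has closed range, then `adjoint A` maps the range of `A` onto the orthogonal complement
of the kernel of `A`. -/
lemma ContinuousLinearMap.exists_adjoint_apply_eq (A : H₁ →L[ℂ] H₂)
    (hA : IsClosed (LinearMap.range (A : H₁ →ₗ[ℂ] H₂) : Set H₂)) {y : H₁}
    (hy : y ∈ (LinearMap.ker (A : H₁ →ₗ[ℂ] H₂))ᗮ) :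
    ∃ x ∈ LinearMap.range (A : H₁ →ₗ[ℂ] H₂), adjoint A x = y := by
  set K := (LinearMap.ker (A : H₁ →ₗ[ℂ] H₂))ᗮ with hK
  set f := A ∘L K.subtypeL with hf
  have hr : LinearMap.range (f : K →ₗ[ℂ] H₂) = LinearMap.range (A : H₁ →ₗ[ℂ] H₂) :=
    A.range_comp_subtypeL_orthogonal_ker
  have hcl : IsClosed (Set.range f) := by rw [← hr] at hA; exact hA
  have hinj : Function.Injective f :=
    LinearMap.ker_eq_bot.mp A.ker_comp_subtypeL_orthogonal_ker
  let e := f.equivRange hinj hcl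
  have : CompleteSpace (LinearMap.range (f : K →ₗ[ℂ] H₂)) := hcl.completeSpace_coe
  set x := adjoint (e.symm : LinearMap.range (f : K →ₗ[ℂ] H₂) →L[ℂ] K) ⟨y, hy⟩ with hx
  refine ⟨x, hr ▸ x.2, ext_inner_right ℂ fun v => ?_⟩
  have hv : A v = e ⟨_, K.starProjection_apply_mem v⟩ :=
    (A.map_starProjection_orthogonal_ker v).symm
  rw [adjoint_inner_left, hv, ← Submodule.coe_inner, hx, adjoint_inner_left]
  simp only [ContinuousLinearEquiv.coe_coe, ContinuousLinearEquiv.symm_apply_apply,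
    Submodule.coe_inner]
  rw [← Submodule.inner_starProjection_left_eq_right, Submodule.starProjection_eq_self_iff.mpr hy]

lemma ContinuousLinearMap.range_adjoint_of_isClosed_range (A : H₁ →L[ℂ] H₂)
    (hA : IsClosed (LinearMap.range (A : H₁ →ₗ[ℂ] H₂) : Set H₂)) :
    LinearMap.range (adjoint A : H₂ →ₗ[ℂ] H₁) = (LinearMap.ker (A : H₁ →ₗ[ℂ] H₂))ᗮ := by
  refine le_antisymm ?_ fun y hy => ?_
  · rw [ContinuousLinearMap.orthogonal_ker]
    exact Submodule.le_topologicalClosure _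
  · obtain ⟨x, -, hx⟩ := A.exists_adjoint_apply_eq hA hy
    exact ⟨x, hx⟩

/-- The cokernel of an operator with closed range is isomorphic to the kernel of its adjoint. -/
def ContinuousLinearMap.cokerEquivKerAdjoint (A : H₁ →L[ℂ] H₂)
    (hA : IsClosed (LinearMap.range (A : H₁ →ₗ[ℂ] H₂) : Set H₂)) :
    (H₂ ⧸ LinearMap.range (A : H₁ →ₗ[ℂ] H₂)) ≃ₗ[ℂ] LinearMap.ker (adjoint A : H₂ →ₗ[ℂ] H₁) :=
  have : CompleteSpace (LinearMap.range (A : H₁ →ₗ[ℂ] H₂)) := hA.completeSpace_coe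
  Submodule.quotientEquivOfIsCompl _ _ (A.orthogonal_range ▸ (Submodule.isCompl_orthogonal _))

lemma IsFredholmOp.adjoint {A : H₁ →L[ℂ] H₂} (hA : IsFredholmOp A) :
    IsFredholmOp (adjoint A) := by
  obtain ⟨h₁, h₂, h₃⟩ := hA
  refine (isFredholmOp_iff _).mpr ⟨Module.Finite.equiv (A.cokerEquivKerAdjoint h₂), ?_⟩
  rw [A.range_adjoint_of_isClosed_range h₂]
  exact Submodule.FG.cofg_of_isCompl (Submodule.isCompl_orthogonal _) (Module.Finite.iff_fg.mp h₁)

lemma IsFredholmOp.opIndex_eq {A : H₁ →L[ℂ] H₂} (hA : IsFredholmOp A) :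
    opIndex A = finrank ℂ (LinearMap.ker (A : H₁ →ₗ[ℂ] H₂)) -
      finrank ℂ (LinearMap.ker (ContinuousLinearMap.adjoint A : H₂ →ₗ[ℂ] H₁)) := by
  rw [opIndex, (A.cokerEquivKerAdjoint hA.2.1).finrank_eq]

lemma IsFredholmOp.opIndex_adjoint {A : H₁ →L[ℂ] H₂} (hA : IsFredholmOp A) :
    opIndex (ContinuousLinearMap.adjoint A) = - opIndex A := by
  rw [hA.opIndex_eq, hA.adjoint.opIndex_eq, adjoint_adjoint, neg_sub]

section ExactPair

variable {S : H₁ →L[ℂ] H₂} {T : H₂ →L[ℂ] H₁}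

lemma ker_add_adjoint_le (hTS : ∀ x, T (S x) = 0) :
    LinearMap.ker (S + adjoint T : H₁ →L[ℂ] H₂).toLinearMap ≤
      LinearMap.ker (S : H₁ →ₗ[ℂ] H₂) ⊓ LinearMap.ker (adjoint T : H₁ →ₗ[ℂ] H₂) := by
  intro x hx
  have h₀ : S x + adjoint T x = 0 := hx
  have hS : S x = 0 := by
    rw [← inner_self_eq_zero (𝕜 := ℂ)]
    nth_rw 2 [eq_neg_of_add_eq_zero_left h₀]
    rw [inner_neg_right, adjoint_inner_right, hTS, inner_zero_left, neg_zero]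
  rw [hS, zero_add] at h₀
  exact ⟨hS, h₀⟩

lemma ker_inf_range_add_adjoint_le (hST : ∀ y, S (T y) = 0) :
    LinearMap.ker (S : H₁ →ₗ[ℂ] H₂) ⊓ LinearMap.range (T + adjoint S : H₂ →L[ℂ] H₁).toLinearMap ≤
      LinearMap.range (T : H₂ →ₗ[ℂ] H₁) := by
  rintro _ ⟨hz, y, rfl⟩
  have hz' : S (T y + adjoint S y) = 0 := hz
  rw [map_add, hST, zero_add] at hz'
  have h : adjoint S y = 0 := by
    rw [← inner_self_eq_zero (𝕜 := ℂ), adjoint_inner_left, hz', inner_zero_right]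
  exact ⟨y, by simp [h]⟩

/-- The natural map from `ker (S + adjoint T)` to the homology space `ker S / range T`. -/
def kerAddAdjointToRelQuot (hTS : ∀ x, T (S x) = 0) :
    LinearMap.ker (S + adjoint T : H₁ →L[ℂ] H₂).toLinearMap →ₗ[ℂ]
      relQuot (LinearMap.ker (S : H₁ →ₗ[ℂ] H₂)) (LinearMap.range (T : H₂ →ₗ[ℂ] H₁)) :=
  Submodule.mkQ _ ∘ₗ Submodule.inclusion ((ker_add_adjoint_le hTS).trans inf_le_left)

lemma kerAddAdjointToRelQuot_injective (hTS : ∀ x, T (S x) = 0) :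
    Function.Injective (kerAddAdjointToRelQuot hTS) := by
  rw [← LinearMap.ker_eq_bot, LinearMap.ker_eq_bot']
  rintro ⟨x, hx⟩ h
  have hx' : x ∈ LinearMap.range (T : H₂ →ₗ[ℂ] H₁) := by
    have := (Submodule.Quotient.mk_eq_zero _).mp h
    exact this.2
  have hxT : x ∈ (LinearMap.range (T : H₂ →ₗ[ℂ] H₁))ᗮ :=
    T.orthogonal_range ▸ (ker_add_adjoint_le hTS hx).2
  exact Subtype.ext ((Submodule.orthogonal_disjoint _).le_bot ⟨hx', hxT⟩)

lemma kerAddAdjointToRelQuot_surjective (hTS : ∀ x, T (S x) = 0) (hST : ∀ y, S (T y) = 0)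
    (hcl : IsClosed (LinearMap.range (T + adjoint S : H₂ →L[ℂ] H₁).toLinearMap : Set H₁)) :
    Function.Surjective (kerAddAdjointToRelQuot hTS) := by
  intro q
  obtain ⟨⟨z, hz⟩, rfl⟩ := Submodule.Quotient.mk_surjective _ q
  set R := LinearMap.range (T + adjoint S : H₂ →L[ℂ] H₁).toLinearMap
  have : CompleteSpace R := hcl.completeSpace_coe
  have hR : Rᗮ = LinearMap.ker (S + adjoint T : H₁ →L[ℂ] H₂).toLinearMap := by
    rw [ContinuousLinearMap.orthogonal_range, map_add, adjoint_adjoint, add_comm]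
  obtain ⟨r, hr, n, hn, rfl⟩ := R.exists_add_mem_mem_orthogonal z
  rw [hR] at hn
  have hnS := (ker_add_adjoint_le hTS hn).1
  have hrS : r ∈ LinearMap.ker (S : H₁ →ₗ[ℂ] H₂) := by
    simpa using Submodule.sub_mem _ hz hnS
  refine ⟨⟨n, hn⟩, ((Submodule.Quotient.eq _).mpr ?_).symm⟩
  have h : r ∈ LinearMap.ker (S : H₁ →ₗ[ℂ] H₂) ⊓ LinearMap.range (T : H₂ →ₗ[ℂ] H₁) :=
    ⟨hrS, ker_inf_range_add_adjoint_le hST ⟨hrS, hr⟩⟩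
  simpa using h.2

/-- If `T ∘ S = 0`, `S ∘ T = 0` and `S + adjoint T` is Fredholm, then `ker (S + adjoint T)` is
isomorphic to the homology space `ker S / range T`. -/
lemma nonempty_ker_add_adjoint_equiv (hTS : ∀ x, T (S x) = 0) (hST : ∀ y, S (T y) = 0)
    (hA : IsFredholmOp (T + adjoint S)) :
    Nonempty (LinearMap.ker (S + adjoint T : H₁ →L[ℂ] H₂).toLinearMap ≃ₗ[ℂ]
      relQuot (LinearMap.ker (S : H₁ →ₗ[ℂ] H₂)) (LinearMap.range (T : H₂ →ₗ[ℂ] H₁))) :=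
  ⟨LinearEquiv.ofBijective _ ⟨kerAddAdjointToRelQuot_injective hTS,
    kerAddAdjointToRelQuot_surjective hTS hST hA.2.1⟩⟩

lemma isClosed_range_of_finite_relQuot (hST : ∀ y, S (T y) = 0)
    (h : FiniteDimensional ℂ
      (relQuot (LinearMap.ker (S : H₁ →ₗ[ℂ] H₂)) (LinearMap.range (T : H₂ →ₗ[ℂ] H₁)))) :
    IsClosed (LinearMap.range (T : H₂ →ₗ[ℂ] H₁) : Set H₁) := by
  set N := LinearMap.ker (S : H₁ →ₗ[ℂ] H₂)
  have hN : IsClosed (N : Set H₁) := S.isClosed_ker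
  have : CompleteSpace N := hN.completeSpace_coe
  set T' : H₂ →L[ℂ] N := T.codRestrict N hST
  have hr : LinearMap.range (T' : H₂ →ₗ[ℂ] N) =
      (N ⊓ LinearMap.range (T : H₂ →ₗ[ℂ] H₁)).comap N.subtype := by
    ext x
    constructor
    · rintro ⟨y, rfl⟩
      exact ⟨hST y, y, rfl⟩
    · rintro ⟨-, y, hy⟩
      exact ⟨y, Subtype.ext hy⟩
  have hcl := T'.isClosed_range_of_coFG (hr ▸ h)
  have := hN.isClosedEmbedding_subtypeVal.isClosedMap _ hcl
  convert this using 1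
  ext x
  constructor
  · rintro ⟨y, rfl⟩
    exact ⟨T' y, ⟨y, rfl⟩, rfl⟩
  · rintro ⟨_, ⟨y, rfl⟩, rfl⟩
    exact ⟨y, rfl⟩

lemma range_sup_orthogonal_ker_le (hST : ∀ y, S (T y) = 0)
    (hcl : IsClosed (LinearMap.range (T : H₂ →ₗ[ℂ] H₁) : Set H₁)) :
    LinearMap.range (S : H₁ →ₗ[ℂ] H₂) ⊔ (LinearMap.ker (T : H₂ →ₗ[ℂ] H₁))ᗮ ≤
      LinearMap.range (S + adjoint T : H₁ →L[ℂ] H₂).toLinearMap := by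
  have : CompleteSpace (LinearMap.range (T : H₂ →ₗ[ℂ] H₁)) := hcl.completeSpace_coe
  refine sup_le ?_ fun y hy => ?_
  · rintro _ ⟨x, rfl⟩
    obtain ⟨_, ⟨v, rfl⟩, n, hn, rfl⟩ :=
      (LinearMap.range (T : H₂ →ₗ[ℂ] H₁)).exists_add_mem_mem_orthogonal x
    rw [T.orthogonal_range] at hn
    have hn' : adjoint T n = 0 := hn
    exact ⟨n, by simp [hn', hST]⟩
  · obtain ⟨_, ⟨v, rfl⟩, hv⟩ := T.exists_adjoint_apply_eq hcl hy
    exact ⟨T v, by simpa [hST] using hv⟩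

lemma isFredholmOp_add_adjoint_of_exact (hTS : ∀ x, T (S x) = 0) (hST : ∀ y, S (T y) = 0)
    (h₁ : FiniteDimensional ℂ
      (relQuot (LinearMap.ker (S : H₁ →ₗ[ℂ] H₂)) (LinearMap.range (T : H₂ →ₗ[ℂ] H₁))))
    (h₂ : FiniteDimensional ℂ
      (relQuot (LinearMap.ker (T : H₂ →ₗ[ℂ] H₁)) (LinearMap.range (S : H₁ →ₗ[ℂ] H₂)))) :
    IsFredholmOp (S + adjoint T) := by
  refine (isFredholmOp_iff _).mpr
    ⟨Module.Finite.of_injective _ (kerAddAdjointToRelQuot_injective hTS), ?_⟩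
  refine Submodule.CoFG.of_le
    (range_sup_orthogonal_ker_le hST (isClosed_range_of_finite_relQuot hST h₁)) ?_
  set N := LinearMap.ker (T : H₂ →ₗ[ℂ] H₁)
  have : CompleteSpace N := T.isClosed_ker.completeSpace_coe
  obtain ⟨G, hG⟩ := ((N ⊓ LinearMap.range (S : H₁ →ₗ[ℂ] H₂)).comap N.subtype).exists_isCompl
  have hGfg : (G.map N.subtype).FG := (Submodule.CoFG.fg_of_isCompl hG h₂).map _
  refine Submodule.CoFG.of_sup_fg (q := G.map N.subtype) ?_ hGfg
  have hN : N ≤ LinearMap.range (S : H₁ →ₗ[ℂ] H₂) ⊔ G.map N.subtype := by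
    calc N = (⊤ : Submodule ℂ N).map N.subtype := N.map_subtype_top.symm
      _ ≤ _ := by
        rw [← hG.sup_eq_top, Submodule.map_sup]
        refine sup_le_sup_right ((Submodule.map_comap_le _ _).trans inf_le_right) _
  have htop : (⊤ : Submodule ℂ H₂) ≤
      LinearMap.range (S : H₁ →ₗ[ℂ] H₂) ⊔ Nᗮ ⊔ G.map N.subtype := by
    rw [← N.isCompl_orthogonal.sup_eq_top, sup_right_comm]
    exact sup_le_sup_right hN _
  exact Submodule.CoFG.of_le htop Submodule.CoFG.top

/-- For operators with `T ∘ S = 0` and `S ∘ T = 0`, the operator `S + adjoint T` is Fredholm if and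
only if both homology spaces are finite dimensional. -/
lemma isFredholmOp_add_adjoint_iff_of_exact (hTS : ∀ x, T (S x) = 0) (hST : ∀ y, S (T y) = 0) :
    IsFredholmOp (S + adjoint T) ↔
      FiniteDimensional ℂ
        (relQuot (LinearMap.ker (S : H₁ →ₗ[ℂ] H₂)) (LinearMap.range (T : H₂ →ₗ[ℂ] H₁))) ∧
      FiniteDimensional ℂ
        (relQuot (LinearMap.ker (T : H₂ →ₗ[ℂ] H₁)) (LinearMap.range (S : H₁ →ₗ[ℂ] H₂))) := by
  refine ⟨fun h => ?_, fun h => isFredholmOp_add_adjoint_of_exact hTS hST h.1 h.2⟩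
  have h' : IsFredholmOp (T + adjoint S) := by
    simpa [add_comm] using h.adjoint
  obtain ⟨e₁⟩ := nonempty_ker_add_adjoint_equiv hTS hST h'
  obtain ⟨e₂⟩ := nonempty_ker_add_adjoint_equiv hST hTS h
  have := h.1
  have := h'.1
  exact ⟨Module.Finite.equiv e₁, Module.Finite.equiv e₂⟩

lemma opIndex_add_adjoint_of_exact (hTS : ∀ x, T (S x) = 0) (hST : ∀ y, S (T y) = 0)
    (h : IsFredholmOp (S + adjoint T)) :
    opIndex (S + adjoint T) =
      finrank ℂ
        (relQuot (LinearMap.ker (S : H₁ →ₗ[ℂ] H₂)) (LinearMap.range (T : H₂ →ₗ[ℂ] H₁))) -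
      finrank ℂ
        (relQuot (LinearMap.ker (T : H₂ →ₗ[ℂ] H₁)) (LinearMap.range (S : H₁ →ₗ[ℂ] H₂))) := by
  have hadj : adjoint (S + adjoint T) = T + adjoint S := by
    rw [map_add, adjoint_adjoint, add_comm]
  have h' : IsFredholmOp (T + adjoint S) := hadj ▸ h.adjoint
  obtain ⟨e₁⟩ := nonempty_ker_add_adjoint_equiv hTS hST h'
  obtain ⟨e₂⟩ := nonempty_ker_add_adjoint_equiv hST hTS h
  rw [h.opIndex_eq, hadj, ← e₁.finrank_eq, ← e₂.finrank_eq]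

end ExactPair

section Truncation

variable (S : H₁ →L[ℂ] H₂) (T : H₂ →L[ℂ] H₁)

/-- The composition of `S` with the orthogonal projection onto `ker (T ∘ S)`. -/
def truncate : H₁ →L[ℂ] H₂ :=
  have : CompleteSpace (LinearMap.ker (T ∘L S).toLinearMap) :=
    (T ∘L S).isClosed_ker.completeSpace_coe
  S ∘L (LinearMap.ker (T ∘L S).toLinearMap).starProjection

omit [CompleteSpace H₂] in
lemma comp_truncate (x : H₁) : T (truncate S T x) = 0 := by
  have : CompleteSpace (LinearMap.ker (T ∘L S).toLinearMap) :=
    (T ∘L S).isClosed_ker.completeSpace_coe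
  exact (LinearMap.ker (T ∘L S).toLinearMap).starProjection_apply_mem x

omit [CompleteSpace H₂] in
lemma truncate_apply_of_mem {x : H₁} (hx : T (S x) = 0) : truncate S T x = S x := by
  have : CompleteSpace (LinearMap.ker (T ∘L S).toLinearMap) :=
    (T ∘L S).isClosed_ker.completeSpace_coe
  have hx' : x ∈ LinearMap.ker (T ∘L S).toLinearMap := hx
  exact congrArg S (Submodule.starProjection_eq_self_iff.mpr hx')

omit [CompleteSpace H₂] in
lemma exists_mem_orthogonal_truncate (x : H₁) :
    ∃ y ∈ (LinearMap.ker (T ∘L S).toLinearMap)ᗮ, S x = truncate S T x + S y ∧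
      truncate S T y = 0 := by
  have : CompleteSpace (LinearMap.ker (T ∘L S).toLinearMap) :=
    (T ∘L S).isClosed_ker.completeSpace_coe
  have hy := (LinearMap.ker (T ∘L S).toLinearMap).sub_starProjection_mem_orthogonal x
  refine ⟨_, hy, by simp [truncate], ?_⟩
  have h : (LinearMap.ker (T ∘L S).toLinearMap).starProjection
      (x - (LinearMap.ker (T ∘L S).toLinearMap).starProjection x) = 0 := by
    rw [map_sub, Submodule.starProjection_eq_self_iff.mpr (Submodule.starProjection_apply_mem _ _),
      sub_self]
  exact (congrArg S h).trans (map_zero S)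

omit [CompleteSpace H₂] in
lemma range_truncate : LinearMap.range (truncate S T : H₁ →ₗ[ℂ] H₂) =
    LinearMap.range (S : H₁ →ₗ[ℂ] H₂) ⊓ LinearMap.ker (T : H₂ →ₗ[ℂ] H₁) := by
  ext y
  constructor
  · rintro ⟨x, rfl⟩
    exact ⟨⟨_, rfl⟩, comp_truncate S T x⟩
  · rintro ⟨⟨x, rfl⟩, hx⟩
    exact ⟨x, truncate_apply_of_mem S T hx⟩

lemma truncate_comp_truncate (y : H₂) : truncate S T (truncate T S y) = 0 := by
  have hS : S (truncate T S y) = 0 := comp_truncate T S y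
  rw [truncate_apply_of_mem S T (by rw [hS, map_zero]), hS]

omit [CompleteSpace H₂] in
lemma ker_le_ker_truncate :
    LinearMap.ker (S : H₁ →ₗ[ℂ] H₂) ≤ LinearMap.ker (truncate S T : H₁ →ₗ[ℂ] H₂) := by
  intro x hx
  have hx' : S x = 0 := hx
  exact (truncate_apply_of_mem S T (by rw [hx', map_zero])).trans hx'

/-- The quotient `ker (truncate S T) / ker S` is isomorphic to the range of `T ∘ S`. -/
def relQuotKerTruncateEquiv :
    relQuot (LinearMap.ker (truncate S T : H₁ →ₗ[ℂ] H₂)) (LinearMap.ker (S : H₁ →ₗ[ℂ] H₂)) ≃ₗ[ℂ]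
      LinearMap.range (T ∘L S).toLinearMap :=
  (relQuotEquivMap (T ∘L S).toLinearMap (by
    ext x
    refine and_congr_right fun hx => ⟨fun h => ?_, fun h => ?_⟩
    · have h' : S x = 0 := h
      simp [h']
    · exact (truncate_apply_of_mem S T h).symm.trans hx)).trans
  (LinearEquiv.ofEq _ _ (by
    refine le_antisymm LinearMap.map_le_range ?_
    rintro _ ⟨x, rfl⟩
    obtain ⟨y, -, hxy, hy⟩ := exists_mem_orthogonal_truncate S T x
    refine ⟨y, hy, ?_⟩
    simp [hxy, comp_truncate]))

/-- The quotient `range S / (range S ⊓ ker T)` is isomorphic to the range of `T ∘ S`. -/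
def relQuotRangeKerEquiv :
    relQuot (LinearMap.range (S : H₁ →ₗ[ℂ] H₂)) (LinearMap.ker (T : H₂ →ₗ[ℂ] H₁)) ≃ₗ[ℂ]
      LinearMap.range (T ∘L S).toLinearMap :=
  (relQuotEquivMap (T : H₂ →ₗ[ℂ] H₁) rfl).trans
    (LinearEquiv.ofEq _ _ (LinearMap.range_comp _ _).symm)

variable {S T}

omit [CompleteSpace H₂] in
lemma fg_orthogonal_ker_of_finite_range {A : H₁ →L[ℂ] H₂}
    (hA : FiniteDimensional ℂ (LinearMap.range (A : H₁ →ₗ[ℂ] H₂))) :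
    (LinearMap.ker (A : H₁ →ₗ[ℂ] H₂))ᗮ.FG := by
  have : CompleteSpace (LinearMap.ker (A : H₁ →ₗ[ℂ] H₂)) := A.isClosed_ker.completeSpace_coe
  exact Submodule.CoFG.fg_of_isCompl (Submodule.isCompl_orthogonal _)
    (Submodule.range_fg_iff_ker_cofg.mp (Module.Finite.iff_fg.mp hA))

omit [CompleteSpace H₂] in
lemma finite_range_sub_truncate
    (hTS : FiniteDimensional ℂ (LinearMap.range (T ∘L S).toLinearMap)) :
    (LinearMap.range (S - truncate S T : H₁ →L[ℂ] H₂).toLinearMap).FG := by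
  refine Submodule.FG.of_le
    ((fg_orthogonal_ker_of_finite_range hTS).map (S : H₁ →ₗ[ℂ] H₂)) ?_
  rintro _ ⟨x, rfl⟩
  obtain ⟨y, hy, hxy, -⟩ := exists_mem_orthogonal_truncate S T x
  exact ⟨y, hy, by simp [hxy]⟩

/-- The adjoint of a finite rank operator has finite rank. -/
lemma finite_range_adjoint {A : H₁ →L[ℂ] H₂}
    (hA : (LinearMap.range (A : H₁ →ₗ[ℂ] H₂)).FG) :
    (LinearMap.range (adjoint A : H₂ →ₗ[ℂ] H₁)).FG := by
  refine Submodule.FG.of_le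
    (fg_orthogonal_ker_of_finite_range (Module.Finite.iff_fg.mpr hA)) ?_
  rw [ContinuousLinearMap.orthogonal_ker]
  exact Submodule.le_topologicalClosure _

lemma finite_range_sub_truncate_add_adjoint
    (hTS : FiniteDimensional ℂ (LinearMap.range (T ∘L S).toLinearMap))
    (hST : FiniteDimensional ℂ (LinearMap.range (S ∘L T).toLinearMap)) :
    (LinearMap.range ((S + adjoint T).toLinearMap -
      (truncate S T + adjoint (truncate T S)).toLinearMap)).FG := by
  refine Submodule.FG.of_le ((finite_range_sub_truncate hTS).sup
    (finite_range_adjoint (finite_range_sub_truncate hST))) ?_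
  rintro _ ⟨x, rfl⟩
  refine Submodule.mem_sup.mpr ⟨_, ⟨x, rfl⟩, _, ⟨x, rfl⟩, ?_⟩
  simp only [map_sub, coe_coe, LinearMap.sub_apply, sub_apply, add_apply]
  abel

lemma IsFredholmOp.of_finite_range_sub {A B : H₁ →L[ℂ] H₂}
    (hAB : (LinearMap.range (A.toLinearMap - B.toLinearMap)).FG) (hA : IsFredholmOp A) :
    IsFredholmOp B :=
  (isFredholmOp_iff B).mpr (finite_ker_coker_of_finite_range_sub hAB hA.1 hA.2.2)

lemma isFredholmOp_iff_of_finite_range_sub {A B : H₁ →L[ℂ] H₂}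
    (hAB : (LinearMap.range (A.toLinearMap - B.toLinearMap)).FG) :
    IsFredholmOp A ↔ IsFredholmOp B := by
  refine ⟨.of_finite_range_sub hAB, .of_finite_range_sub ?_⟩
  rwa [← neg_sub, LinearMap.range_neg]

lemma relQuot_truncate
    (hTS : FiniteDimensional ℂ (LinearMap.range (T ∘L S).toLinearMap)) :
    (FiniteDimensional ℂ (relQuot (LinearMap.ker (truncate S T : H₁ →ₗ[ℂ] H₂))
        (LinearMap.range (truncate T S : H₂ →ₗ[ℂ] H₁))) ↔
      FiniteDimensional ℂ
        (relQuot (LinearMap.ker (S : H₁ →ₗ[ℂ] H₂)) (LinearMap.range (T : H₂ →ₗ[ℂ] H₁)))) ∧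
    (FiniteDimensional ℂ
        (relQuot (LinearMap.ker (S : H₁ →ₗ[ℂ] H₂)) (LinearMap.range (T : H₂ →ₗ[ℂ] H₁))) →
      finrank ℂ (relQuot (LinearMap.ker (truncate S T : H₁ →ₗ[ℂ] H₂))
        (LinearMap.range (truncate T S : H₂ →ₗ[ℂ] H₁))) =
      finrank ℂ
        (relQuot (LinearMap.range (S : H₁ →ₗ[ℂ] H₂)) (LinearMap.ker (T : H₂ →ₗ[ℂ] H₁))) +
      finrank ℂ
        (relQuot (LinearMap.ker (S : H₁ →ₗ[ℂ] H₂)) (LinearMap.range (T : H₂ →ₗ[ℂ] H₁)))) := by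
  have hd : LinearMap.range (truncate T S : H₂ →ₗ[ℂ] H₁) ≤ LinearMap.ker (S : H₁ →ₗ[ℂ] H₂) := by
    rw [range_truncate]
    exact inf_le_right
  have e : relQuot (LinearMap.ker (S : H₁ →ₗ[ℂ] H₂))
      (LinearMap.range (truncate T S : H₂ →ₗ[ℂ] H₁)) ≃ₗ[ℂ]
      relQuot (LinearMap.ker (S : H₁ →ₗ[ℂ] H₂)) (LinearMap.range (T : H₂ →ₗ[ℂ] H₁)) :=
    Submodule.quotEquivOfEq _ _ (by rw [inf_eq_right.mpr hd, range_truncate, inf_comm])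
  obtain ⟨h₁, h₂⟩ := relQuot_tower hd (ker_le_ker_truncate S T)
    (Module.Finite.equiv (relQuotKerTruncateEquiv S T).symm)
  refine ⟨h₁.trans ⟨fun _ => Module.Finite.equiv e, fun _ => Module.Finite.equiv e.symm⟩, fun h => ?_⟩
  rw [h₂ (Module.Finite.equiv e.symm), e.finrank_eq, (relQuotKerTruncateEquiv S T).finrank_eq,
    (relQuotRangeKerEquiv S T).finrank_eq]

omit [CompleteSpace H₁] [CompleteSpace H₂] in
lemma isFredholmPair_iff
    (hTS : FiniteDimensional ℂ (LinearMap.range (T ∘L S).toLinearMap))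
    (hST : FiniteDimensional ℂ (LinearMap.range (S ∘L T).toLinearMap)) :
    IsFredholmPair S T ↔
      FiniteDimensional ℂ
        (relQuot (LinearMap.ker (S : H₁ →ₗ[ℂ] H₂)) (LinearMap.range (T : H₂ →ₗ[ℂ] H₁))) ∧
      FiniteDimensional ℂ
        (relQuot (LinearMap.ker (T : H₂ →ₗ[ℂ] H₁)) (LinearMap.range (S : H₁ →ₗ[ℂ] H₂))) :=
  ⟨fun h => ⟨h.1, h.2.2.1⟩, fun h => ⟨h.1, Module.Finite.equiv (relQuotRangeKerEquiv T S).symm,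
    h.2, Module.Finite.equiv (relQuotRangeKerEquiv S T).symm⟩⟩

lemma isFredholmPair_iff_isFredholmOp
    (hTS : FiniteDimensional ℂ (LinearMap.range (T ∘L S).toLinearMap))
    (hST : FiniteDimensional ℂ (LinearMap.range (S ∘L T).toLinearMap)) :
    IsFredholmPair S T ↔ IsFredholmOp (S + adjoint T) := by
  rw [isFredholmPair_iff hTS hST,
    isFredholmOp_iff_of_finite_range_sub (finite_range_sub_truncate_add_adjoint hTS hST),
    isFredholmOp_add_adjoint_iff_of_exact (truncate_comp_truncate T S) (truncate_comp_truncate S T),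
    (relQuot_truncate hTS).1, (relQuot_truncate hST).1]

lemma pairIndex_eq_opIndex
    (hTS : FiniteDimensional ℂ (LinearMap.range (T ∘L S).toLinearMap))
    (hST : FiniteDimensional ℂ (LinearMap.range (S ∘L T).toLinearMap))
    (h : IsFredholmPair S T) : pairIndex S T = opIndex (S + adjoint T) := by
  have hA := (isFredholmPair_iff_isFredholmOp hTS hST).mp h
  have hfin := finite_range_sub_truncate_add_adjoint hTS hST
  have hindex : opIndex (S + adjoint T) = opIndex (truncate S T + adjoint (truncate T S)) :=
    LinearMap.index_eq_of_finite_range_sub hfin hA.1 hA.2.2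
  rw [hindex, opIndex_add_adjoint_of_exact (truncate_comp_truncate T S)
    (truncate_comp_truncate S T) (hA.of_finite_range_sub hfin),
    (relQuot_truncate hTS).2 h.1, (relQuot_truncate hST).2 h.2.2.1, pairIndex]
  push_cast
  ring

end Truncation

end Hilbert

variable {H₁ H₂ : Type*} [NormedAddCommGroup H₁] [InnerProductSpace ℂ H₁] [CompleteSpace H₁]
  [NormedAddCommGroup H₂] [InnerProductSpace ℂ H₂] [CompleteSpace H₂]

theorem fredholm_pair_iff_fredholm_op (S : H₁ →L[ℂ] H₂) (T : H₂ →L[ℂ] H₁)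
    (hTS : FiniteDimensional ℂ (LinearMap.range (T ∘L S).toLinearMap))
    (hST : FiniteDimensional ℂ (LinearMap.range (S ∘L T).toLinearMap)) :
    ([IsFredholmPair S T,
      IsFredholmOp (S + adjoint T),
      IsFredholmOp (T + adjoint S)].TFAE) ∧
    (IsFredholmPair S T → pairIndex S T = opIndex (S + adjoint T) ∧
      opIndex (S + adjoint T) = - opIndex (T + adjoint S)) := by
  have hadj : adjoint (S + adjoint T) = T + adjoint S := by
    rw [map_add, adjoint_adjoint, add_comm]
  have hadj' : adjoint (T + adjoint S) = S + adjoint T := by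
    rw [map_add, adjoint_adjoint, add_comm]
  refine ⟨?_, fun h => ⟨pairIndex_eq_opIndex hTS hST h, ?_⟩⟩
  · tfae_have 1 ↔ 2 := isFredholmPair_iff_isFredholmOp hTS hST
    tfae_have 2 → 3 := fun h => hadj ▸ h.adjoint
    tfae_have 3 → 2 := fun h => hadj' ▸ h.adjoint
    tfae_finish
  · rw [← hadj, ((isFredholmPair_iff_isFredholmOp hTS hST).mp h).opIndex_adjoint, neg_neg]
end
end

section
/- Let H₁ and H₂ be Hilbert spaces and let (S,T) be a Fredholm pair, S ∈ L(H₁,H₂), T ∈ L(H₂,H₁). Let K ∈ K(H₁,H₂) and K′ ∈ K(H₂,H₁) be compact operators and set S₁ = S + K and T₁ = T + K′. Suppose that R(T₁S₁) and R(S₁T₁) are finite-dimensional subspaces of H₁ and H₂ respectively. Then (S₁,T₁) is a Fredholm pair and ind(S,T) = ind(S₁,T₁). -/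
open Module ContinuousLinearMap

noncomputable section

set_option maxHeartbeats 1000000
set_option synthInstance.maxHeartbeats 1000000

section Algebra

namespace LinearMap

variable {k V W X V' W' : Type*} [Field k] [AddCommGroup V] [Module k V]
  [AddCommGroup W] [Module k W] [AddCommGroup X] [Module k X]
  [AddCommGroup V'] [Module k V'] [AddCommGroup W'] [Module k W']

/-- A linear map is algebraically Fredholm if its kernel and its cokernel are finite
dimensional. -/
structure IsAlgFredholm (f : V →ₗ[k] W) : Prop where
  finite_ker : FiniteDimensional k (ker f)
  finite_coker : FiniteDimensional k (W ⧸ range f)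

theorem IsAlgFredholm.comp {g : W →ₗ[k] X} {f : V →ₗ[k] W} (hg : g.IsAlgFredholm)
    (hf : f.IsAlgFredholm) : (g ∘ₗ f).IsAlgFredholm := by
  have := hg.finite_ker
  have := hg.finite_coker
  have := hf.finite_ker
  have := hf.finite_coker
  constructor
  · rw [ker_comp]; infer_instance
  · rw [range_comp]; infer_instance

theorem IsAlgFredholm.index_comp {g : W →ₗ[k] X} {f : V →ₗ[k] W} (hg : g.IsAlgFredholm)
    (hf : f.IsAlgFredholm) : (g ∘ₗ f).index = g.index + f.index := by
  have := hg.finite_ker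
  have := hg.finite_coker
  have := hf.finite_ker
  have := hf.finite_coker
  exact LinearMap.index_comp g

theorem IsAlgFredholm.of_comp {f : V →ₗ[k] W} {g : W →ₗ[k] X} {h : V' →ₗ[k] V}
    (hgf : (g ∘ₗ f).IsAlgFredholm) (hfh : (f ∘ₗ h).IsAlgFredholm) : f.IsAlgFredholm := by
  have := hgf.finite_ker
  exact ⟨Submodule.finiteDimensional_of_le (ker_le_ker_comp f g),
    Submodule.CoFG.of_le (range_comp_le_range h f) hfh.finite_coker⟩

theorem isAlgFredholm_of_bijective {f : V →ₗ[k] W} (hf : Function.Bijective f) :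
    f.IsAlgFredholm := by
  constructor
  · rw [ker_eq_bot.mpr hf.1]; infer_instance
  · rw [range_eq_top.mpr hf.2]; infer_instance

theorem index_eq_zero_of_bijective {f : V →ₗ[k] W} (hf : Function.Bijective f) :
    f.index = 0 :=
  LinearEquiv.index_eq_zero (e := LinearEquiv.ofBijective f hf)

theorem isAlgFredholm_subtype {A : Submodule k V} (hA : A.CoFG) : A.subtype.IsAlgFredholm := by
  constructor
  · rw [Submodule.ker_subtype]; infer_instance
  · rwa [Submodule.range_subtype]

theorem isAlgFredholm_id_add {F : V →ₗ[k] V} (hF : FiniteDimensional k (range F)) :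
    (id + F).IsAlgFredholm := by
  constructor
  · refine Submodule.finiteDimensional_of_le (S₂ := range F) fun x hx ↦ ⟨-x, ?_⟩
    have : x + F x = 0 := hx
    rw [map_neg, eq_comm, ← sub_eq_zero, sub_neg_eq_add, this]
  · refine Submodule.CoFG.of_le (S := ker F) (fun x hx ↦ ⟨x, ?_⟩)
      (Submodule.range_fg_iff_ker_cofg.mp (Module.Finite.iff_fg.mp hF))
    simp [mem_ker.mp hx]

theorem index_id_add {F : V →ₗ[k] V} (hF : FiniteDimensional k (range F)) :
    (id + F).index = 0 := by
  have hA := isAlgFredholm_subtype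
    (Submodule.range_fg_iff_ker_cofg.mp (Module.Finite.iff_fg.mp hF))
  have h := (isAlgFredholm_id_add hF).index_comp hA
  have hj : (id + F) ∘ₗ (ker F).subtype = (ker F).subtype := by
    ext x
    simp
  rw [hj] at h
  omega

/-- A commutative square that is bijective on kernels and cokernels preserves the algebraic
Fredholm property and the index. -/
theorem isAlgFredholm_iff_and_index_eq_of_square {f : V →ₗ[k] W} {f' : V' →ₗ[k] W'}
    (i : V →ₗ[k] V') (j : W →ₗ[k] W') (hij : ∀ x, f' (i x) = j (f x))
    (ker_inj : ∀ x, f x = 0 → i x = 0 → x = 0)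
    (ker_surj : ∀ y, f' y = 0 → ∃ x, f x = 0 ∧ i x = y)
    (coker_inj : ∀ w y, j w = f' y → w ∈ range f)
    (coker_surj : ∀ w', ∃ w y, w' = j w + f' y) :
    (f'.IsAlgFredholm ↔ f.IsAlgFredholm) ∧ f'.index = f.index := by
  have hi : ∀ x ∈ ker f, i x ∈ ker f' := fun x hx ↦ by
    rw [mem_ker] at *
    rw [hij, hx, map_zero]
  have hj : range f ≤ (range f').comap j := by
    rintro _ ⟨x, rfl⟩
    exact ⟨i x, hij x⟩
  let e₀ : ker f ≃ₗ[k] ker f' := LinearEquiv.ofBijective (i.restrict hi) <| by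
    constructor
    · rw [← ker_eq_bot, ker_eq_bot']
      rintro ⟨x, hx⟩ h
      have : i x = 0 := congrArg Subtype.val h
      exact Subtype.ext (ker_inj x hx this)
    · rintro ⟨y, hy⟩
      obtain ⟨x, hx, hxy⟩ := ker_surj y hy
      exact ⟨⟨x, hx⟩, Subtype.ext hxy⟩
  let e₁ : (W ⧸ range f) ≃ₗ[k] W' ⧸ range f' :=
    LinearEquiv.ofBijective ((range f).mapQ (range f') j hj) <| by
      constructor
      · rw [← ker_eq_bot, ker_eq_bot']
        intro w
        obtain ⟨w, rfl⟩ := (range f).mkQ_surjective w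
        intro h
        rw [Submodule.mkQ_apply, Submodule.mapQ_apply, Submodule.Quotient.mk_eq_zero] at h
        obtain ⟨y, hy⟩ := h
        rw [Submodule.mkQ_apply, Submodule.Quotient.mk_eq_zero]
        exact coker_inj w y hy.symm
      · intro w'
        obtain ⟨w', rfl⟩ := (range f').mkQ_surjective w'
        obtain ⟨w, y, rfl⟩ := coker_surj w'
        refine ⟨(range f).mkQ w, ?_⟩
        rw [Submodule.mkQ_apply, Submodule.mkQ_apply, Submodule.mapQ_apply,
          Submodule.Quotient.eq, sub_add_cancel_left]
        exact neg_mem ⟨y, rfl⟩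
  refine ⟨⟨fun ⟨_, _⟩ ↦ ⟨e₀.symm.finiteDimensional, e₁.symm.finiteDimensional⟩,
    fun ⟨_, _⟩ ↦ ⟨e₀.finiteDimensional, e₁.finiteDimensional⟩⟩, ?_⟩
  rw [index_eq_finrank_sub, index_eq_finrank_sub, e₀.finrank_eq, e₁.finrank_eq]

theorem isAlgFredholm_prod_iff_and_index_eq {p : V →ₗ[k] W} {q : V →ₗ[k] X}
    (hp : Function.Surjective p) :
    ((p.prod q).IsAlgFredholm ↔ (q ∘ₗ (ker p).subtype).IsAlgFredholm) ∧
      (p.prod q).index = (q ∘ₗ (ker p).subtype).index := by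
  refine isAlgFredholm_iff_and_index_eq_of_square (ker p).subtype (inr k W X)
    (fun x ↦ ?_) (fun x _ hx ↦ Subtype.ext hx) (fun y hy ↦ ?_) (fun w y hwy ↦ ?_)
    (fun w ↦ ?_)
  · exact Prod.ext x.2 rfl
  · exact ⟨⟨y, congrArg Prod.fst hy⟩, congrArg Prod.snd hy, rfl⟩
  · exact ⟨⟨y, (congrArg Prod.fst hwy).symm⟩, (congrArg Prod.snd hwy).symm⟩
  · obtain ⟨y, hy⟩ := hp w.1
    exact ⟨w.2 - q y, y, by ext <;> simp [hy]⟩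

theorem isAlgFredholm_mkQ_comp_iff_and_index_eq {u : V →ₗ[k] W} {C : Submodule k W} :
    ((C.mkQ ∘ₗ u).IsAlgFredholm ↔ (u.coprod C.subtype).IsAlgFredholm) ∧
      (C.mkQ ∘ₗ u).index = (u.coprod C.subtype).index := by
  refine isAlgFredholm_iff_and_index_eq_of_square (fst k V C) C.mkQ
    (fun x ↦ ?_) (fun x h₀ hx ↦ ?_) (fun y hy ↦ ?_) (fun w y hwy ↦ ?_) (fun w ↦ ?_)
  · simp
  · have hx : x.1 = 0 := hx
    have h₀ : u x.1 + x.2 = 0 := h₀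
    rw [hx, map_zero, zero_add] at h₀
    exact Prod.ext hx (Subtype.ext h₀)
  · rw [comp_apply, Submodule.mkQ_apply, Submodule.Quotient.mk_eq_zero] at hy
    exact ⟨(y, -⟨u y, hy⟩), by simp, rfl⟩
  · rw [comp_apply, Submodule.mkQ_apply, Submodule.mkQ_apply, Submodule.Quotient.eq] at hwy
    exact ⟨(y, ⟨w - u y, hwy⟩), by simp⟩
  · obtain ⟨w, rfl⟩ := C.mkQ_surjective w
    exact ⟨w, 0, by simp⟩

end LinearMap

section RelQuot

variable {E X : Type*} [AddCommGroup E] [Module ℂ E] [AddCommGroup X] [Module ℂ X]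

theorem range_inclusion_inf_left (p q : Submodule ℂ E) :
    LinearMap.range (Submodule.inclusion (inf_le_left : p ⊓ q ≤ p)) =
      (p ⊓ q).comap p.subtype :=
  Submodule.range_inclusion _ _ _

theorem range_inclusion_inf_right (p q : Submodule ℂ E) :
    LinearMap.range (Submodule.inclusion (inf_le_right : p ⊓ q ≤ q)) =
      (q ⊓ p).comap q.subtype := by
  rw [Submodule.range_inclusion, inf_comm]

/-- If `A` and `B` are commensurable subspaces and `r` is bijective on `B`, then `r` restricted to
`A` is algebraically Fredholm, and its index is the relative dimension of `A` and `B`. -/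
theorem isAlgFredholm_domRestrict_of_commensurable {A B : Submodule ℂ E} (r : E →ₗ[ℂ] X)
    (hr : Function.Bijective (r ∘ₗ B.subtype)) (hAB : FiniteDimensional ℂ (relQuot A B))
    (hBA : FiniteDimensional ℂ (relQuot B A)) :
    (r ∘ₗ A.subtype).IsAlgFredholm ∧
      (r ∘ₗ A.subtype).index =
        (finrank ℂ (relQuot A B) : ℤ) - (finrank ℂ (relQuot B A) : ℤ) := by
  set iA := Submodule.inclusion (inf_le_left : A ⊓ B ≤ A)
  set iB := Submodule.inclusion (inf_le_right : A ⊓ B ≤ B)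
  have hA : iA.IsAlgFredholm := by
    constructor
    · rw [Submodule.ker_inclusion]; infer_instance
    · rwa [range_inclusion_inf_left]
  have hB : iB.IsAlgFredholm := by
    constructor
    · rw [Submodule.ker_inclusion]; infer_instance
    · rwa [range_inclusion_inf_right]
  have iA_index : iA.index = -(finrank ℂ (relQuot A B) : ℤ) := by
    rw [LinearMap.index_of_injective (Submodule.inclusion_injective _),
      range_inclusion_inf_left]
  have iB_index : iB.index = -(finrank ℂ (relQuot B A) : ℤ) := by
    rw [LinearMap.index_of_injective (Submodule.inclusion_injective _),
      range_inclusion_inf_right]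
  have hrB := LinearMap.isAlgFredholm_of_bijective hr
  have comm : (r ∘ₗ A.subtype) ∘ₗ iA = (r ∘ₗ B.subtype) ∘ₗ iB := rfl
  have hcomp := hrB.comp hB
  have hrA : (r ∘ₗ A.subtype).IsAlgFredholm := by
    constructor
    · refine Module.Finite.iff_fg.mpr
        (Submodule.CoFG.fg_of_disjoint (T := LinearMap.range iA) ?_ hA.finite_coker)
      rw [Submodule.disjoint_def]
      rintro _ hx ⟨y, rfl⟩
      have : (r ∘ₗ B.subtype) (iB y) = 0 := hx
      have hy : iB y = 0 := hr.1 (this.trans (map_zero _).symm)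
      have : y = 0 := Submodule.inclusion_injective _ (hy.trans (map_zero _).symm)
      rw [this, map_zero]
    · rw [← comm] at hcomp
      exact Submodule.CoFG.of_le (LinearMap.range_comp_le_range iA _) hcomp.finite_coker
  refine ⟨hrA, ?_⟩
  have h₁ := hrA.index_comp hA
  have h₂ := hrB.index_comp hB
  rw [← comm, h₁, LinearMap.index_eq_zero_of_bijective hr, iA_index, iB_index] at h₂
  omega

end RelQuot

end Algebra

section Hilbert

open scoped InnerProduct

variable {E F : Type*} [NormedAddCommGroup E] [InnerProductSpace ℂ E]
  [NormedAddCommGroup F] [InnerProductSpace ℂ F]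

theorem IsCompactOperator.exists_norm_sub_starProjection_comp_le {C : E →L[ℂ] F}
    (hC : IsCompactOperator C) {ε : ℝ} (hε : 0 < ε) :
    ∃ V : Submodule ℂ F, ∃ _ : FiniteDimensional ℂ V, ‖C - V.starProjection ∘L C‖ ≤ ε := by
  obtain ⟨t, ht, htC⟩ := Metric.totallyBounded_iff.mp
    (IsCompactOperator.isCompact_closure_image_closedBall (f := (C : E →ₗ[ℂ] F)) hC
      1).totallyBounded ε hε
  have := FiniteDimensional.span_of_finite ℂ ht
  refine ⟨Submodule.span ℂ t, this, ?_⟩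
  refine opNorm_le_of_unit_norm hε.le fun x hx ↦ ?_
  have hx' : C x ∈ closure (C '' Metric.closedBall 0 1) :=
    subset_closure ⟨x, by simp [hx], rfl⟩
  obtain ⟨y, hy, hxy⟩ := Set.mem_iUnion₂.mp (htC hx')
  have hmin : ‖C x - (Submodule.span ℂ t).starProjection (C x)‖ ≤ ‖C x - y‖ := by
    rw [Submodule.starProjection_minimal]
    exact ciInf_le ⟨0, by rintro _ ⟨z, rfl⟩; exact norm_nonneg _⟩
      (⟨y, Submodule.subset_span hy⟩ : Submodule.span ℂ t)
  exact hmin.trans (by simpa [dist_eq_norm] using (Metric.mem_ball.mp hxy).le)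

theorem ContinuousLinearMap.isCompactOperator_of_finiteDimensional_range {f : E →L[ℂ] F}
    (hf : FiniteDimensional ℂ f.range) : IsCompactOperator f := by
  have := FiniteDimensional.proper ℂ f.range
  have : IsCompactOperator f.rangeRestrict :=
    isCompactOperator_of_locallyCompactSpace_dom f.rangeRestrict
  exact this.clm_comp f.range.subtypeL

theorem IsFredholmPair.symm {S : E →L[ℂ] F} {T : F →L[ℂ] E} (h : IsFredholmPair S T) :
    IsFredholmPair T S :=
  ⟨h.2.2.1, h.2.2.2, h.1, h.2.1⟩

theorem finiteDimensional_relQuot_range_ker {S : E →L[ℂ] F} {T : F →L[ℂ] E}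
    (h : FiniteDimensional ℂ (S ∘L T).range) :
    FiniteDimensional ℂ (relQuot T.range S.ker) := by
  have hker : (T.range ⊓ S.ker).comap T.range.subtype =
      LinearMap.ker (S.toLinearMap ∘ₗ T.range.subtype) := by
    ext x
    exact ⟨fun hx ↦ hx.2, fun hx ↦ ⟨x.2, hx⟩⟩
  change ((T.range ⊓ S.ker).comap T.range.subtype).CoFG
  rw [hker]
  refine Submodule.range_fg_iff_ker_cofg.mp (Module.Finite.iff_fg.mp ?_)
  refine Submodule.finiteDimensional_of_le (S₂ := (S ∘L T).range) ?_
  rintro _ ⟨⟨_, x, rfl⟩, rfl⟩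
  exact ⟨x, rfl⟩

variable [CompleteSpace E] [CompleteSpace F]

theorem ContinuousLinearMap.isClosed_range_of_cofg {f : E →L[ℂ] F} (hf : f.range.CoFG) :
    IsClosed (f.range : Set F) := by
  obtain ⟨G, hG⟩ := f.range.exists_isCompl
  have : FiniteDimensional ℂ G := .of_fg (Submodule.CoFG.fg_of_isCompl hG hf)
  have hsurj : Function.Surjective (f.coprod G.subtypeL) := by
    intro y
    obtain ⟨_, ⟨x, rfl⟩, g, hg, rfl⟩ :=
      Submodule.mem_sup.mp (hG.sup_eq_top.ge (Submodule.mem_top (x := y)))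
    exact ⟨(x, ⟨g, hg⟩), rfl⟩
  have hq : Topology.IsQuotientMap (f.coprod G.subtypeL) :=
    ((f.coprod G.subtypeL).isOpenMap hsurj).isQuotientMap (map_continuous _) hsurj
  rw [← hq.isClosed_preimage]
  have : f.coprod G.subtypeL ⁻¹' (f.range : Set F) = Prod.snd ⁻¹' {(0 : G)} := by
    ext ⟨x, g⟩
    change f x + g ∈ f.range ↔ g = 0
    rw [f.range.add_mem_iff_right (show f x ∈ f.range from ⟨x, rfl⟩)]
    refine ⟨fun h ↦ Subtype.ext (Submodule.disjoint_def.mp hG.disjoint _ h g.2), ?_⟩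
    rintro rfl
    exact zero_mem _
  rw [this]
  exact isClosed_singleton.preimage continuous_snd

theorem ContinuousLinearMap.exists_comp_comp_eq_self {f : E →L[ℂ] F}
    (hf : IsClosed (f.range : Set F)) : ∃ g : F →L[ℂ] E, ∀ x, f (g (f x)) = f x := by
  set f₀ : f.kerᗮ →L[ℂ] F := f ∘L f.kerᗮ.subtypeL with hf₀
  have hP : ∀ x, ∃ z : f.kerᗮ, f₀ z = f x := fun x ↦ by
    obtain ⟨y, hy, z, hz, rfl⟩ := Submodule.mem_sup.mp
      ((Submodule.isCompl_orthogonal (K := f.ker)).sup_eq_top.ge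
        (Submodule.mem_top (x := x)))
    have hy : f y = 0 := hy
    exact ⟨⟨z, hz⟩, by simp [hf₀, hy]⟩
  have hrange : Set.range f₀ = f.range := by
    ext y
    constructor
    · rintro ⟨z, rfl⟩
      exact ⟨z, rfl⟩
    · rintro ⟨x, rfl⟩
      exact hP x
  have hrange' : f₀.range = f.range := SetLike.coe_injective hrange
  have hinj : Function.Injective f₀ := by
    refine (injective_iff_map_eq_zero f₀).mpr fun z hz ↦ ?_
    exact Subtype.ext (Submodule.disjoint_def.mp f.ker.orthogonal_disjoint _ hz z.2)
  have : CompleteSpace f.range := hf.completeSpace_coe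
  obtain ⟨g, hg⟩ := HasLeftInverse.of_injective_of_isClosed_range_of_closedComplement_range hinj
    (hrange ▸ hf) (hrange' ▸
      ⟨f.range.orthogonalProjectionOnto, Submodule.orthogonalProjectionOnto_mem_subspace_eq_self⟩)
  refine ⟨f.kerᗮ.subtypeL ∘L g, fun x ↦ ?_⟩
  obtain ⟨z, hz⟩ := hP x
  rw [← hz]
  exact congrArg f₀ (hg z)

theorem ContinuousLinearMap.range_adjoint_eq_orthogonal_ker {f : E →L[ℂ] F}
    (hf : IsClosed (f.range : Set F)) : f†.range = f.kerᗮ := by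
  refine le_antisymm (f.orthogonal_ker ▸ Submodule.le_topologicalClosure _) fun y hy ↦ ?_
  obtain ⟨g, hg⟩ := f.exists_comp_comp_eq_self hf
  refine ⟨(g†) y, ext_inner_left ℂ fun w ↦ ?_⟩
  have hw : w - g (f w) ∈ f.ker := by
    change f (w - g (f w)) = 0
    rw [map_sub, hg, sub_self]
  have := hy _ hw
  rw [inner_sub_left, sub_eq_zero] at this
  rw [this]
  change inner ℂ w ((f†) ((g†) y)) = _
  rw [adjoint_inner_right, adjoint_inner_right]

theorem IsCompactOperator.adjoint {C : E →L[ℂ] F} (hC : IsCompactOperator C) :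
    IsCompactOperator (C†) := by
  have : C† ∈ closure {f : F →L[ℂ] E | IsCompactOperator f} := by
    refine Metric.mem_closure_iff.mpr fun ε hε ↦ ?_
    obtain ⟨V, hV, hle⟩ := hC.exists_norm_sub_starProjection_comp_le (half_pos hε)
    refine ⟨(V.starProjection ∘L C)†, ?_, ?_⟩
    · have : IsCompactOperator V.starProjection :=
        isCompactOperator_of_finiteDimensional_range
          (by rw [Submodule.range_starProjection]; exact hV)
      rw [adjoint_comp, V.starProjection_isSymmetric.clm_adjoint_eq]
      exact this.clm_comp (C†)
    · rw [dist_eq_norm, ← map_sub, LinearIsometryEquiv.norm_map]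
      linarith
  rwa [isClosed_setOfPred_isCompactOperator.closure_eq] at this

theorem ContinuousLinearMap.isAlgFredholm_and_index_eq_zero_of_sub_id {A : E →L[ℂ] E}
    (hA : IsCompactOperator (A - ContinuousLinearMap.id ℂ E)) :
    A.toLinearMap.IsAlgFredholm ∧ A.toLinearMap.index = 0 := by
  set C := A - ContinuousLinearMap.id ℂ E with hC
  obtain ⟨V, hV, hle⟩ := hA.exists_norm_sub_starProjection_comp_le one_half_pos
  obtain ⟨u, hu⟩ : IsUnit (1 - (V.starProjection ∘L C - C)) := by
    refine isUnit_one_sub_of_norm_lt_one ?_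
    rw [norm_sub_rev]
    linarith
  set G : E →L[ℂ] E := u⁻¹.1 * (V.starProjection ∘L C) with hG
  have hG_range : FiniteDimensional ℂ G.range := by
    have h : (V.starProjection ∘L C).range ≤ V := by
      rintro _ ⟨x, rfl⟩
      exact V.starProjection_apply_mem _
    have : G.range = (V.starProjection ∘L C).range.map u⁻¹.1.toLinearMap :=
      LinearMap.range_comp _ _
    rw [this]
    have := Submodule.finiteDimensional_of_le h
    infer_instance
  have hA_eq : A.toLinearMap = u.1.toLinearMap ∘ₗ (LinearMap.id + G.toLinearMap) := by
    have : A = u.1 * (1 + G) := by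
      rw [mul_add, mul_one, hG, u.mul_inv_cancel_left, hu, hC]
      change A = ContinuousLinearMap.id ℂ E - _ + _
      abel
    rw [this]
    rfl
  have hu_bij : Function.Bijective u.1.toLinearMap := by
    refine Function.bijective_iff_has_inverse.mpr ⟨u⁻¹.1, fun x ↦ ?_, fun x ↦ ?_⟩
    · exact congrArg (fun f : E →L[ℂ] E ↦ f x) u.inv_mul
    · exact congrArg (fun f : E →L[ℂ] E ↦ f x) u.mul_inv
  have h₁ := LinearMap.isAlgFredholm_of_bijective hu_bij
  have h₂ := LinearMap.isAlgFredholm_id_add hG_range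
  rw [hA_eq]
  refine ⟨h₁.comp h₂, ?_⟩
  rw [h₁.index_comp h₂, LinearMap.index_eq_zero_of_bijective hu_bij,
    LinearMap.index_id_add hG_range, add_zero]

/-- The algebraic Fredholm property and the index of a bounded operator are stable under compact
perturbations. -/
theorem ContinuousLinearMap.isAlgFredholm_add_and_index_add_eq {D K : E →L[ℂ] F}
    (hD : D.toLinearMap.IsAlgFredholm) (hK : IsCompactOperator K) :
    (D + K).toLinearMap.IsAlgFredholm ∧
      (D + K).toLinearMap.index = D.toLinearMap.index := by
  obtain ⟨g, hg⟩ := D.exists_comp_comp_eq_self (D.isClosed_range_of_cofg hD.finite_coker)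
  have hgD : IsCompactOperator (g ∘L D - ContinuousLinearMap.id ℂ E) := by
    refine isCompactOperator_of_finiteDimensional_range ?_
    have := hD.finite_ker
    refine Submodule.finiteDimensional_of_le (S₂ := D.ker) ?_
    rintro _ ⟨x, rfl⟩
    change D (g (D x) - x) = 0
    rw [map_sub, hg, sub_self]
  have hDg : IsCompactOperator (D ∘L g - ContinuousLinearMap.id ℂ F) := by
    refine isCompactOperator_of_finiteDimensional_range
      (Module.Finite.iff_fg.mpr (Submodule.range_fg_iff_ker_cofg.mpr ?_))
    refine Submodule.CoFG.of_le ?_ hD.finite_coker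
    rintro _ ⟨x, rfl⟩
    change D (g (D x)) - D x = 0
    rw [hg, sub_self]
  have hgDK : IsCompactOperator (g ∘L (D + K) - ContinuousLinearMap.id ℂ E) := by
    refine (congrArg IsCompactOperator (funext fun x ↦ ?_)).mpr (hgD.add (hK.clm_comp g))
    simp
    abel
  have hDKg : IsCompactOperator ((D + K) ∘L g - ContinuousLinearMap.id ℂ F) := by
    refine (congrArg IsCompactOperator (funext fun x ↦ ?_)).mpr (hDg.add (hK.comp_clm g))
    simp
    abel
  have h₁ := isAlgFredholm_and_index_eq_zero_of_sub_id hgD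
  have h₂ := isAlgFredholm_and_index_eq_zero_of_sub_id hDg
  have h₃ := isAlgFredholm_and_index_eq_zero_of_sub_id hgDK
  have h₄ := isAlgFredholm_and_index_eq_zero_of_sub_id hDKg
  have hgF : g.toLinearMap.IsAlgFredholm := .of_comp h₂.1 h₁.1
  have hDKF : (D + K).toLinearMap.IsAlgFredholm := .of_comp h₃.1 h₄.1
  refine ⟨hDKF, ?_⟩
  have e₁ := hgF.index_comp hD
  have e₂ := hgF.index_comp hDKF
  have e₃ : (g.toLinearMap ∘ₗ D.toLinearMap).index = 0 := h₁.2
  have e₄ : (g.toLinearMap ∘ₗ (D + K).toLinearMap).index = 0 := h₃.2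
  omega

section Pair

variable {S : E →L[ℂ] F} {T : F →L[ℂ] E}

theorem IsFredholmPair.isClosed_range (h : IsFredholmPair S T) :
    IsClosed (T.range : Set E) := by
  obtain ⟨hker, hrange, -, -⟩ := h
  set s : Submodule ℂ F := S.ker.comap T.toLinearMap
  have hs_closed : IsClosed (s : Set F) := S.isClosed_ker.preimage T.continuous
  have : CompleteSpace S.ker := S.isClosed_ker.completeSpace_coe
  have : CompleteSpace s := hs_closed.completeSpace_coe
  have hs_cofg : s.CoFG := by
    set q := ((T.range ⊓ S.ker).comap T.range.subtype).mkQ ∘ₗ T.toLinearMap.rangeRestrict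
    have hq : LinearMap.ker q = s := by
      ext x
      rw [LinearMap.mem_ker, LinearMap.comp_apply, Submodule.mkQ_apply,
        Submodule.Quotient.mk_eq_zero]
      exact ⟨fun hx ↦ hx.2, fun hx ↦ ⟨⟨x, rfl⟩, hx⟩⟩
    rw [← hq]
    exact Submodule.CoFG.ker q
  set T₀ : s →L[ℂ] S.ker := (T ∘L s.subtypeL).codRestrict S.ker fun x ↦ x.2
  have hT₀_range : T₀.range = (S.ker ⊓ T.range).comap S.ker.subtype := by
    ext x
    constructor
    · rintro ⟨y, rfl⟩
      exact ⟨(T₀ y).2, y, rfl⟩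
    · rintro ⟨hx, y, hy⟩
      have hy : T y = x := hy
      exact ⟨⟨y, show T y ∈ S.ker from hy ▸ hx⟩, Subtype.ext hy⟩
  have hT₀_closed := T₀.isClosed_range_of_cofg (hT₀_range ▸ hker)
  refine LinearMap.isClosed_range_of_isClosed_map_of_finiteDimensional_quotient (s := s) ?_
  convert S.isClosed_ker.isClosedMap_subtype_val _ hT₀_closed using 1
  ext x
  constructor
  · rintro ⟨y, hy, rfl⟩
    exact ⟨T₀ ⟨y, hy⟩, ⟨_, rfl⟩, rfl⟩
  · rintro ⟨_, ⟨y, rfl⟩, rfl⟩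
    exact ⟨y, y.2, rfl⟩

/-- A Fredholm pair `(S, T)` gives rise to the Fredholm operator `S + T†`, with the same index. -/
theorem IsFredholmPair.isAlgFredholm_add_adjoint_and_index_eq (h : IsFredholmPair S T) :
    (S + T†).toLinearMap.IsAlgFredholm ∧ (S + T†).toLinearMap.index = pairIndex S T := by
  have hT := h.isClosed_range
  have hT' := T.range_adjoint_eq_orthogonal_ker hT
  have : CompleteSpace T.range := hT.completeSpace_coe
  set r := (T†).toLinearMap.rangeRestrict
  have hr_bij : Function.Bijective (r ∘ₗ T.range.subtype) := by
    constructor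
    · refine (injective_iff_map_eq_zero _).mpr fun x hx ↦ ?_
      have hx : (x : E) ∈ (T†).ker := congrArg Subtype.val hx
      rw [← T.orthogonal_range] at hx
      exact Subtype.ext (Submodule.disjoint_def.mp T.range.orthogonal_disjoint _ x.2 hx)
    · rintro ⟨_, x, rfl⟩
      obtain ⟨y, hy, z, hz, rfl⟩ := Submodule.mem_sup.mp
        ((Submodule.isCompl_orthogonal (K := T.range)).sup_eq_top.ge (Submodule.mem_top (x := x)))
      rw [T.orthogonal_range] at hz
      have hz : (T†) z = 0 := hz
      refine ⟨⟨y, hy⟩, Subtype.ext ?_⟩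
      change (T†) y = (T†) (y + z)
      rw [map_add, hz, add_zero]
  have hq_bij : Function.Bijective ((T†).range.mkQ ∘ₗ T.ker.subtype) := by
    have hcompl : IsCompl (T†).range T.ker := hT' ▸ (Submodule.isCompl_orthogonal (K := T.ker)).symm
    exact (Submodule.quotientEquivOfIsCompl _ _ hcompl).symm.bijective
  obtain ⟨hA, hA_index⟩ := isAlgFredholm_domRestrict_of_commensurable r hr_bij h.1 h.2.1
  obtain ⟨hB, hB_index⟩ :=
    isAlgFredholm_domRestrict_of_commensurable _ hq_bij h.2.2.2 h.2.2.1
  have ha := LinearMap.isAlgFredholm_prod_iff_and_index_eq (q := r)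
    S.toLinearMap.surjective_rangeRestrict
  have hb := LinearMap.isAlgFredholm_mkQ_comp_iff_and_index_eq
    (u := S.range.subtype) (C := (T†).range)
  rw [LinearMap.ker_rangeRestrict] at ha
  have hcomp : (S + T†).toLinearMap = (S.range.subtype.coprod (T†).range.subtype) ∘ₗ
      (S.toLinearMap.rangeRestrict.prod r) := rfl
  have hF₁ := ha.1.mpr hA
  have hF₂ := hb.1.mp hB
  rw [hcomp]
  refine ⟨hF₂.comp hF₁, ?_⟩
  rw [hF₂.index_comp hF₁, ← hb.2, ha.2, hA_index, hB_index, pairIndex]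
  ring

theorem finiteDimensional_relQuot_ker_range (hTS : (T + S†).range.CoFG)
    (h : FiniteDimensional ℂ (S ∘L T).range) :
    FiniteDimensional ℂ (relQuot S.ker T.range) := by
  have : CompleteSpace S.ker := S.isClosed_ker.completeSpace_coe
  set P := S.ker.orthogonalProjectionOnto.toLinearMap
  have hP_range : (LinearMap.range P).CoFG := by
    have hP_surj : Function.Surjective P := fun x ↦
      ⟨x, Submodule.orthogonalProjectionOnto_mem_subspace_eq_self x⟩
    rw [LinearMap.range_eq_top.mpr hP_surj]
    infer_instance
  have hPT : P ∘ₗ T.toLinearMap = P ∘ₗ (T + S†).toLinearMap := by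
    ext x
    have hx : (S†) x ∈ S.kerᗮ := S.orthogonal_ker ▸ Submodule.le_topologicalClosure _ ⟨x, rfl⟩
    have : P ((S†) x) = 0 := Submodule.orthogonalProjectionOnto_apply_of_mem_orthogonal hx
    change ((P (T x) : S.ker) : E) = (P (T x + (S†) x) : S.ker)
    rw [map_add, this, add_zero]
  have hPT_range : (LinearMap.range (P ∘ₗ T.toLinearMap)).CoFG := by
    rw [hPT, LinearMap.range_comp]
    infer_instance
  have hs : (S ∘L T).ker.CoFG :=
    Submodule.range_fg_iff_ker_cofg.mp (Module.Finite.iff_fg.mp h)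
  have hmap : ((S ∘L T).ker.map (P ∘ₗ T.toLinearMap)).CoFG := by
    rw [← Submodule.range_subtype (S ∘L T).ker] at hs ⊢
    infer_instance
  refine Submodule.CoFG.of_le ?_ hmap
  rintro _ ⟨x, hx, rfl⟩
  have hx : T x ∈ S.ker := hx
  have hPx : P (T x) = ⟨T x, hx⟩ :=
    Submodule.orthogonalProjectionOnto_mem_subspace_eq_self (⟨T x, hx⟩ : S.ker)
  refine ⟨(P (T x)).2, x, ?_⟩
  change T x = P (T x)
  rw [hPx]

end Pair

end Hilbert

variable {H₁ H₂ : Type*} [NormedAddCommGroup H₁] [InnerProductSpace ℂ H₁] [CompleteSpace H₁]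
  [NormedAddCommGroup H₂] [InnerProductSpace ℂ H₂] [CompleteSpace H₂]

theorem fredholm_pair_compact_stability (S : H₁ →L[ℂ] H₂) (T : H₂ →L[ℂ] H₁)
    (h : IsFredholmPair S T) (K : H₁ →L[ℂ] H₂) (K' : H₂ →L[ℂ] H₁)
    (hK : IsCompactOperator (⇑K)) (hK' : IsCompactOperator (⇑K'))
    (hTS : FiniteDimensional ℂ (LinearMap.range (((T + K') ∘L (S + K) : H₁ →L[ℂ] H₁) : H₁ →ₗ[ℂ] H₁)))
    (hST : FiniteDimensional ℂ (LinearMap.range (((S + K) ∘L (T + K') : H₂ →L[ℂ] H₂) : H₂ →ₗ[ℂ] H₂))) :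
    IsFredholmPair (S + K) (T + K') ∧ pairIndex S T = pairIndex (S + K) (T + K') := by
  obtain ⟨hD, hD_index⟩ := h.isAlgFredholm_add_adjoint_and_index_eq
  have hD' := h.symm.isAlgFredholm_add_adjoint_and_index_eq.1
  obtain ⟨hD₁, hD₁_index⟩ := isAlgFredholm_add_and_index_add_eq (K := K + adjoint K') hD
    (hK.add hK'.adjoint)
  have hD₁' := (isAlgFredholm_add_and_index_add_eq (K := K' + adjoint K) hD'
    (hK'.add hK.adjoint)).1
  have e : S + adjoint T + (K + adjoint K') = S + K + adjoint (T + K') := by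
    rw [map_add]
    abel
  have e' : T + adjoint S + (K' + adjoint K) = T + K' + adjoint (S + K) := by
    rw [map_add]
    abel
  rw [e] at hD₁ hD₁_index
  rw [e'] at hD₁'
  have h₁ : IsFredholmPair (S + K) (T + K') :=
    ⟨finiteDimensional_relQuot_ker_range hD₁'.finite_coker hST,
      finiteDimensional_relQuot_range_ker hST,
      finiteDimensional_relQuot_ker_range hD₁.finite_coker hTS,
      finiteDimensional_relQuot_range_ker hTS⟩
  exact ⟨h₁, by rw [← hD_index, ← hD₁_index, h₁.isAlgFredholm_add_adjoint_and_index_eq.2]⟩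
end
end
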